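/- Let l ≥ 2 and d ≥ 3 be integers and let p > d/(d-2). Then the l-linear discrete spherical maximal operator T* is bounded from l^∞(ℤ^d) × ⋯ × l^∞(ℤ^d) × l^p(ℤ^d) to l^p(ℤ^d): there exists a constant C = C(l,d,p) such that for all f₁, …, f_{l-1} ∈ l^∞(ℤ^d) and f_l ∈ l^p(ℤ^d), ‖T*(f₁,…,f_l)‖_{l^p(ℤ^d)} ≤ C ‖f₁‖_{l^∞(ℤ^d)} ⋯ ‖f_{l-1}‖_{l^∞(ℤ^d)} ‖f_l‖_{l^p(ℤ^d)}. -/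

import Mathlib

open scoped ENNReal NNReal BigOperators

noncomputable section

/-- `ℤ^d` -/
abbrev V (d : ℕ) := Fin d → ℤ

/-- The sphere `{(u₁,…,u_m) ∈ (ℤ^d)^m : |u₁|² + ⋯ + |u_m|² = λ}`. -/
def sphM (m d lam : ℕ) : Set (Fin m → V d) :=
  {u | ∑ j, ∑ i, u j i ^ 2 = (lam : ℤ)}

/-- `N_m(λ)`, the number of lattice points on the sphere of radius `λ^{1/2}` in `ℝ^{md}`. -/
def NcountM (m d lam : ℕ) : ℕ := Nat.card (sphM m d lam)

/-- The `m`-linear discrete spherical average `T_λ(f₁,…,f_m)(x)`. -/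
def avgM (m d lam : ℕ) (f : Fin m → V d → ℂ) (x : V d) : ℂ :=
  (NcountM m d lam : ℂ)⁻¹ *
    ∑' u : sphM m d lam, ∏ j, f j (x - (u : Fin m → V d) j)

/-- The `m`-linear discrete spherical maximal function
`T*(f₁,…,f_m)(x) = sup_{λ ∈ ℕ, N_m(λ)>0} |T_λ(f₁,…,f_m)(x)|`. -/
def maxOpM (m d : ℕ) (f : Fin m → V d → ℂ) (x : V d) : ℝ≥0∞ :=
  ⨆ (lam : ℕ) (_ : 0 < NcountM m d lam), (‖avgM m d lam f x‖₊ : ℝ≥0∞)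

/-- The `l^p(ℤ^d)` norm of a complex-valued function. -/
def lpNorm (d : ℕ) (p : ℝ) (f : V d → ℂ) : ℝ≥0∞ :=
  (∑' x : V d, (‖f x‖₊ : ℝ≥0∞) ^ p) ^ (1 / p)

/-- The `l^p(ℤ^d)` norm of an `ℝ≥0∞`-valued function. -/
def lpNormE (d : ℕ) (p : ℝ) (F : V d → ℝ≥0∞) : ℝ≥0∞ :=
  (∑' x : V d, F x ^ p) ^ (1 / p)

/-- The `l^∞(ℤ^d)` norm. -/
def linftyNorm (d : ℕ) (f : V d → ℂ) : ℝ≥0∞ :=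
  ⨆ x : V d, (‖f x‖₊ : ℝ≥0∞)

/-- The cube of side length `2 * N + 1` centred at the origin of `ℤ^d`. -/
def cube (d N : ℕ) : Finset (V d) := Fintype.piFinset fun _ => Finset.Icc (-(N : ℤ)) N

lemma mem_cube {d N : ℕ} {u : V d} : u ∈ cube d N ↔ ∀ i, |u i| ≤ N := by
  simp [cube, abs_le]

lemma card_cube (d N : ℕ) : (cube d N).card = (2 * N + 1) ^ d := by
  simp only [cube, Fintype.card_piFinset, Int.card_Icc, Finset.prod_const, Finset.card_univ,
    Fintype.card_fin]
  congr 1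
  omega

/-- The Hardy–Littlewood maximal function over centred cubes in `ℤ^d`. -/
def hlMax (d : ℕ) (g : V d → ℝ≥0∞) (x : V d) : ℝ≥0∞ :=
  ⨆ N : ℕ, ((2 * N + 1 : ℝ≥0∞) ^ d)⁻¹ * ∑ u ∈ cube d N, g (x - u)

lemma mem_closedBall_iff_sub_mem_cube {d N : ℕ} {x y : V d} :
    y ∈ Metric.closedBall x (N : ℝ) ↔ x - y ∈ cube d N := by
  rw [mem_cube, Metric.mem_closedBall, dist_pi_le_iff (by positivity)]
  refine forall_congr' fun i => ?_
  rw [Int.dist_eq, abs_sub_comm, Pi.sub_apply]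
  exact_mod_cast Iff.rfl

lemma sum_cube_sub {d N : ℕ} (g : V d → ℝ≥0∞) (x : V d) :
    ∑ u ∈ cube d N, g (x - u) = ∑ y ∈ (cube d N).image (fun u => x - u), g y := by
  rw [Finset.sum_image]
  intro a _ b _ h
  simpa using h

lemma hlMax_weak_type_finset {d : ℕ} (g : V d → ℝ≥0∞) {s : ℝ≥0∞} (K : Finset (V d))
    (hK : ∀ x ∈ K, s < hlMax d g x) : s * K.card ≤ 4 ^ d * ∑' y, g y := by
  classical
  have h1 : ∀ x ∈ K, ∃ N : ℕ, s * (2 * N + 1 : ℝ≥0∞) ^ d ≤ ∑ u ∈ cube d N, g (x - u) := by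
    intro x hx
    obtain ⟨N, hN⟩ := lt_iSup_iff.1 (hK x hx)
    refine ⟨N, ?_⟩
    have h0 : (2 * N + 1 : ℝ≥0∞) ^ d ≠ 0 := by positivity
    have h2 : (2 * N + 1 : ℝ≥0∞) ^ d ≠ ⊤ := by
      refine ENNReal.pow_ne_top ?_
      exact_mod_cast ENNReal.natCast_ne_top (2 * N + 1)
    rw [← ENNReal.div_eq_inv_mul] at hN
    exact ENNReal.mul_le_of_le_div hN.le
  choose! N hN using h1
  obtain ⟨u, huK, hdisj, hcov⟩ := Vitali.exists_disjoint_subfamily_covering_enlargement_closedBall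
    (K : Set (V d)) id (fun x => (N x : ℝ)) (∑ x ∈ K, (N x : ℝ))
    (fun a ha => Finset.single_le_sum (f := fun x => (N x : ℝ)) (fun _ _ => by positivity) ha) 4
    (by norm_num)
  have hufin : u.Finite := K.finite_toSet.subset huK
  lift u to Finset (V d) using hufin
  have hcard : K.card ≤ ∑ b ∈ u, (2 * (4 * N b) + 1) ^ d := by
    have : K ⊆ u.biUnion fun b => (cube d (4 * N b)).image fun v => b - v := by
      intro a ha
      obtain ⟨b, hb, hab⟩ := hcov a ha
      have h3 : a ∈ Metric.closedBall b ((4 * N b : ℕ) : ℝ) := by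
        have := hab (Metric.mem_closedBall_self (by positivity))
        simpa using this
      rw [mem_closedBall_iff_sub_mem_cube] at h3
      exact Finset.mem_biUnion.2 ⟨b, hb, Finset.mem_image.2 ⟨b - a, h3, by abel⟩⟩
    refine (Finset.card_le_card this).trans (Finset.card_biUnion_le.trans ?_)
    refine Finset.sum_le_sum fun b _ => Finset.card_image_le.trans ?_
    rw [card_cube]
  calc s * K.card ≤ s * ∑ b ∈ u, (4 : ℝ≥0∞) ^ d * (2 * N b + 1 : ℝ≥0∞) ^ d := by
        gcongr
        have h4 : (K.card : ℝ≥0∞) ≤ ((∑ b ∈ u, (2 * (4 * N b) + 1) ^ d : ℕ) : ℝ≥0∞) := by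
          exact_mod_cast hcard
        refine h4.trans ?_
        push_cast
        refine Finset.sum_le_sum fun b _ => ?_
        rw [← mul_pow]
        gcongr
        calc (2 * (4 * N b) + 1 : ℝ≥0∞) ≤ 2 * (4 * N b) + 4 := by gcongr; norm_num
          _ = 4 * (2 * N b + 1) := by ring
    _ = 4 ^ d * ∑ b ∈ u, s * (2 * N b + 1 : ℝ≥0∞) ^ d := by
        rw [Finset.mul_sum, Finset.mul_sum]
        refine Finset.sum_congr rfl fun b _ => by ring
    _ ≤ 4 ^ d * ∑ b ∈ u, ∑ y ∈ (cube d (N b)).image (fun v => b - v), g y := by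
        gcongr with b hb
        rw [← sum_cube_sub]
        exact hN b (huK hb)
    _ = 4 ^ d * ∑ y ∈ u.biUnion (fun b => (cube d (N b)).image (fun v => b - v)), g y := by
        rw [Finset.sum_biUnion]
        intro a ha b hb hab
        have := hdisj ha hb hab
        rw [Function.onFun, Finset.disjoint_left]
        intro y hya hyb
        have key : ∀ c : V d, y ∈ (cube d (N c)).image (fun v => c - v) →
            y ∈ Metric.closedBall c (N c : ℝ) := by
          intro c hc
          obtain ⟨v, hv, rfl⟩ := Finset.mem_image.1 hc
          rw [mem_closedBall_iff_sub_mem_cube]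
          simpa using hv
        exact Set.disjoint_left.1 this (key a hya) (key b hyb)
    _ ≤ 4 ^ d * ∑' y, g y := by
        gcongr
        exact ENNReal.sum_le_tsum _

lemma hlMax_weak_type {d : ℕ} (g : V d → ℝ≥0∞) (s : ℝ≥0∞) :
    s * ∑' x, (if s < hlMax d g x then 1 else 0) ≤ 4 ^ d * ∑' y, g y := by
  classical
  rw [ENNReal.tsum_eq_iSup_sum, ENNReal.mul_iSup]
  refine iSup_le fun F => ?_
  rw [Finset.sum_ite, Finset.sum_const_zero, add_zero, Finset.sum_const, nsmul_one]
  exact hlMax_weak_type_finset g _ fun x hx => (Finset.mem_filter.1 hx).2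

lemma hlMax_add_le {d : ℕ} (g h : V d → ℝ≥0∞) (x : V d) :
    hlMax d (fun y => g y + h y) x ≤ hlMax d g x + hlMax d h x := by
  refine iSup_le fun N => ?_
  rw [Finset.sum_add_distrib, mul_add]
  exact add_le_add (le_iSup (fun N : ℕ => ((2 * N + 1 : ℝ≥0∞) ^ d)⁻¹ * ∑ u ∈ cube d N, g (x - u)) N)
    (le_iSup (fun N : ℕ => ((2 * N + 1 : ℝ≥0∞) ^ d)⁻¹ * ∑ u ∈ cube d N, h (x - u)) N)

lemma hlMax_le_of_le {d : ℕ} {g : V d → ℝ≥0∞} {s : ℝ≥0∞} (hg : ∀ y, g y ≤ s) (x : V d) :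
    hlMax d g x ≤ s := by
  refine iSup_le fun N => ?_
  have h0 : (2 * N + 1 : ℝ≥0∞) ^ d ≠ 0 := by positivity
  have h2 : (2 * N + 1 : ℝ≥0∞) ^ d ≠ ⊤ := by
    refine ENNReal.pow_ne_top ?_
    exact_mod_cast ENNReal.natCast_ne_top (2 * N + 1)
  have : ∑ u ∈ cube d N, g (x - u) ≤ (2 * N + 1 : ℝ≥0∞) ^ d * s := by
    refine (Finset.sum_le_card_nsmul _ _ s fun u _ => hg _).trans ?_
    rw [card_cube, nsmul_eq_mul]
    push_cast
    exact le_rfl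
  calc _ ≤ ((2 * N + 1 : ℝ≥0∞) ^ d)⁻¹ * ((2 * N + 1 : ℝ≥0∞) ^ d * s) := by gcongr
    _ = s := by rw [← mul_assoc, ENNReal.inv_mul_cancel h0 h2, one_mul]

lemma hlMax_level_set {d : ℕ} (g : V d → ℝ≥0∞) (s : ℝ≥0∞) :
    s * ∑' x, (if 2 * s < hlMax d g x then 1 else 0) ≤
      4 ^ d * ∑' y, (if s < g y then g y else 0) := by
  refine le_trans ?_ (hlMax_weak_type (fun y => if s < g y then g y else 0) s)
  gcongr with x
  by_cases h : 2 * s < hlMax d g x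
  · have : s < hlMax d (fun y => if s < g y then g y else 0) x := by
      by_contra hc
      push Not at hc
      refine absurd h (not_lt.2 ?_)
      calc hlMax d g x = hlMax d (fun y => (if s < g y then g y else 0) +
            (if s < g y then 0 else g y)) x := by
            congr 1; funext y; split_ifs <;> simp
        _ ≤ _ := hlMax_add_le _ _ x
        _ ≤ s + s := add_le_add hc (hlMax_le_of_le (fun y => by
            split_ifs with h1
            · exact zero_le
            · exact not_lt.1 h1) x)
        _ = 2 * s := by ring
    simp [h, this]
  · simp [h]

/-- The truncated power integral `∫_{0 < s, s < a} s^{r} ds`. -/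
lemma lintegral_rpow_lt {r : ℝ} (hr : 0 < r) {a : ℝ} (ha : 0 ≤ a) :
    ∫⁻ s in Set.Ioi (0 : ℝ), (if ENNReal.ofReal s < ENNReal.ofReal a then
      ENNReal.ofReal (s ^ (r - 1)) else 0) = ENNReal.ofReal (a ^ r / r) := by
  have h1 : ∫⁻ s in Set.Ioi (0 : ℝ), (if ENNReal.ofReal s < ENNReal.ofReal a then
      ENNReal.ofReal (s ^ (r - 1)) else 0) =
      ∫⁻ s in Set.Ioo (0 : ℝ) a, ENNReal.ofReal (s ^ (r - 1)) := by
    rw [← MeasureTheory.lintegral_indicator measurableSet_Ioi,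
      ← MeasureTheory.lintegral_indicator measurableSet_Ioo]
    congr 1
    funext s
    by_cases h0 : 0 < s
    · simp [Set.indicator, h0, ENNReal.ofReal_lt_ofReal_iff_of_nonneg h0.le]
    · simp [Set.indicator, h0]
  have h2 : IntervalIntegrable (fun s : ℝ => s ^ (r - 1)) MeasureTheory.volume 0 a :=
    intervalIntegral.intervalIntegrable_rpow' (by linarith)
  rw [h1, MeasureTheory.restrict_Ioo_eq_restrict_Ioc,
    ← MeasureTheory.ofReal_integral_eq_lintegral_ofReal
      ((intervalIntegrable_iff_integrableOn_Ioc_of_le ha).1 h2),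
    ← intervalIntegral.integral_of_le ha, integral_rpow (Or.inl (by linarith))]
  · congr 1
    rw [sub_add_cancel, Real.zero_rpow hr.ne', sub_zero]
  · filter_upwards [MeasureTheory.ae_restrict_mem measurableSet_Ioc] with s hs
    exact Real.rpow_nonneg hs.1.le _

lemma lintegral_rpow_lt_ennreal {r : ℝ} (hr : 0 < r) {a : ℝ≥0∞} (ha : a ≠ ⊤) :
    ENNReal.ofReal r * ∫⁻ s in Set.Ioi (0 : ℝ), (if ENNReal.ofReal s < a then
      ENNReal.ofReal (s ^ (r - 1)) else 0) = a ^ r := by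
  lift a to ℝ≥0 using ha
  have := lintegral_rpow_lt hr a.2
  simp only [ENNReal.ofReal_coe_nnreal, NNReal.val_eq_coe] at this
  rw [this, ← ENNReal.ofReal_mul hr.le, mul_div_cancel₀ _ hr.ne',
    ← ENNReal.ofReal_rpow_of_nonneg a.coe_nonneg hr.le, ENNReal.ofReal_coe_nnreal]

lemma measurable_ite_rpow (r : ℝ) (a c : ℝ≥0∞) : Measurable fun s : ℝ =>
    (if ENNReal.ofReal s < a then c * ENNReal.ofReal (s ^ r) else 0) := by
  refine Measurable.ite (measurableSet_lt ENNReal.measurable_ofReal measurable_const) ?_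
    measurable_const
  exact measurable_const.mul (ENNReal.measurable_ofReal.comp (by fun_prop))

/-- The Hardy–Littlewood maximal theorem on `ℤ^d`. -/
theorem hlMax_strong_type (d : ℕ) {p : ℝ} (hp : 1 < p) :
    ∃ C : ℝ≥0, ∀ g : V d → ℝ≥0∞, ∑' x, hlMax d g x ^ p ≤ C * ∑' x, g x ^ p := by
  have hp0 : 0 < p := by linarith
  have hp1 : 0 < p - 1 := by linarith
  set D : ℝ≥0∞ := ENNReal.ofReal p * (2 * 4 ^ d) * (ENNReal.ofReal (p - 1))⁻¹ * 2 ^ (p - 1) with hD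
  have hDtop : D ≠ ⊤ := by
    refine ENNReal.mul_ne_top (ENNReal.mul_ne_top (ENNReal.mul_ne_top ENNReal.ofReal_ne_top
      (ENNReal.mul_ne_top (by norm_num) (ENNReal.pow_ne_top (by norm_num)))) ?_) ?_
    · simpa using hp1
    · exact ENNReal.rpow_ne_top_of_nonneg hp1.le (by norm_num)
  have hD0 : D ≠ 0 := by
    refine mul_ne_zero (mul_ne_zero (mul_ne_zero (by simpa using hp0) (by positivity)) ?_) ?_
    · exact ENNReal.inv_ne_zero.2 ENNReal.ofReal_ne_top
    · exact (ENNReal.rpow_pos (by norm_num) (by norm_num)).ne'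
  refine ⟨D.toNNReal, fun g => ?_⟩
  rw [ENNReal.coe_toNNReal hDtop]
  by_cases hfin : ∑' x, g x ^ p = ⊤
  · rw [hfin, ENNReal.mul_top hD0]
    exact le_top
  set B : ℝ≥0∞ := (∑' x, g x ^ p) ^ (1 / p) with hB
  have hBtop : B ≠ ⊤ := ENNReal.rpow_ne_top_of_nonneg (by positivity) hfin
  have hgB : ∀ y, g y ≤ B := by
    intro y
    have := ENNReal.rpow_le_rpow (ENNReal.le_tsum (f := fun x => g x ^ p) y)
      (show 0 ≤ 1 / p by positivity)
    rwa [one_div, ENNReal.rpow_rpow_inv hp0.ne', ← one_div] at this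
  have hgtop : ∀ y, g y ≠ ⊤ := fun y => ne_top_of_le_ne_top hBtop (hgB y)
  have hMtop : ∀ x, hlMax d g x ≠ ⊤ := fun x =>
    ne_top_of_le_ne_top hBtop (hlMax_le_of_le hgB x)
  have hmeas : ∀ (r : ℝ) (a : ℝ≥0∞), Measurable fun s : ℝ =>
      (if ENNReal.ofReal s < a then ENNReal.ofReal (s ^ r) else 0) := fun r a => by
    simpa using measurable_ite_rpow r a 1
  calc ∑' x, hlMax d g x ^ p
      = ∑' x, ENNReal.ofReal p * ∫⁻ s in Set.Ioi (0 : ℝ), (if ENNReal.ofReal s < hlMax d g x then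
        ENNReal.ofReal (s ^ (p - 1)) else 0) :=
        tsum_congr fun x => (lintegral_rpow_lt_ennreal hp0 (hMtop x)).symm
    _ = ENNReal.ofReal p * ∫⁻ s in Set.Ioi (0 : ℝ), ∑' x,
        (if ENNReal.ofReal s < hlMax d g x then ENNReal.ofReal (s ^ (p - 1)) else 0) := by
        rw [ENNReal.tsum_mul_left, MeasureTheory.lintegral_tsum]
        exact fun x => (hmeas _ _).aemeasurable
    _ ≤ ENNReal.ofReal p * ∫⁻ s in Set.Ioi (0 : ℝ), ∑' y,
        (if ENNReal.ofReal s < 2 * g y then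
          (2 * 4 ^ d * g y) * ENNReal.ofReal (s ^ (p - 1 - 1)) else 0) := by
        gcongr 1
        refine MeasureTheory.setLIntegral_mono' measurableSet_Ioi fun s hs => ?_
        have hs0 : (0 : ℝ) < s := hs
        have key := hlMax_level_set g (ENNReal.ofReal (s / 2))
        have h2 : 2 * ENNReal.ofReal (s / 2) = ENNReal.ofReal s := by
          rw [show (2 : ℝ≥0∞) = ENNReal.ofReal 2 by simp, ← ENNReal.ofReal_mul (by norm_num)]
          congr 1; ring
        have h3 : ∀ y, (ENNReal.ofReal (s / 2) < g y) ↔ ENNReal.ofReal s < 2 * g y := by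
          intro y
          rw [← h2]
          exact (ENNReal.mul_lt_mul_iff_right (by norm_num) (by norm_num)).symm
        simp only [h2, h3] at key
        have h4 : ENNReal.ofReal (s ^ (p - 1)) =
            2 * ENNReal.ofReal (s ^ (p - 1 - 1)) * ENNReal.ofReal (s / 2) := by
          rw [mul_right_comm, h2, ← ENNReal.ofReal_mul hs0.le, mul_comm s,
            ← Real.rpow_add_one hs0.ne']
          congr 2; ring
        calc ∑' x, (if ENNReal.ofReal s < hlMax d g x then ENNReal.ofReal (s ^ (p - 1)) else 0)
            = 2 * ENNReal.ofReal (s ^ (p - 1 - 1)) * (ENNReal.ofReal (s / 2) *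
              ∑' x, (if ENNReal.ofReal s < hlMax d g x then 1 else 0)) := by
              rw [← mul_assoc, ← h4, ← ENNReal.tsum_mul_left]
              exact tsum_congr fun x => by split_ifs <;> simp
          _ ≤ 2 * ENNReal.ofReal (s ^ (p - 1 - 1)) *
              (4 ^ d * ∑' y, (if ENNReal.ofReal s < 2 * g y then g y else 0)) := by gcongr
          _ = _ := by
              rw [← mul_assoc, ← ENNReal.tsum_mul_left]
              exact tsum_congr fun x => by
                split_ifs
                · ring
                · simp
    _ = ENNReal.ofReal p * ∑' y, (2 * 4 ^ d * g y) * ((ENNReal.ofReal (p - 1))⁻¹ *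
          (2 * g y) ^ (p - 1)) := by
        rw [MeasureTheory.lintegral_tsum fun y => (measurable_ite_rpow _ _ _).aemeasurable]
        congr 1
        refine tsum_congr fun y => ?_
        rw [← lintegral_rpow_lt_ennreal hp1 (ENNReal.mul_ne_top (by norm_num) (hgtop y)),
          ← mul_assoc (ENNReal.ofReal (p - 1))⁻¹, ENNReal.inv_mul_cancel (by simpa using hp1)
          ENNReal.ofReal_ne_top, one_mul, ← MeasureTheory.lintegral_const_mul _ (hmeas _ _)]
        congr 1
        funext s
        split_ifs <;> simp
    _ = D * ∑' x, g x ^ p := by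
        rw [← ENNReal.tsum_mul_left, ← ENNReal.tsum_mul_left]
        refine tsum_congr fun y => ?_
        have h5 : g y ^ p = g y ^ (p - 1) * g y := by
          by_cases h0 : g y = 0
          · simp [h0, hp0]
          · conv_rhs => rw [← ENNReal.rpow_one (g y), ← ENNReal.rpow_mul, one_mul]
            rw [← ENNReal.rpow_add _ _ h0 (hgtop y), sub_add_cancel]
        rw [h5, ENNReal.mul_rpow_of_nonneg _ _ hp1.le, hD]
        ring

/-- The number of representations of `m` as a sum of `k` squares of integers. -/
def rep (k : ℕ) (m : ℤ) : ℕ := Nat.card {v : Fin k → ℤ // ∑ i, v i ^ 2 = m}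

lemma finite_sum_sq_eq {ι : Type*} [Fintype ι] (m : ℤ) :
    {v : ι → ℤ | ∑ i, v i ^ 2 = m}.Finite := by
  classical
  refine (Fintype.piFinset fun _ : ι => Finset.Icc (-m) m).finite_toSet.subset fun v hv => ?_
  simp only [Finset.mem_coe, Fintype.mem_piFinset, Finset.mem_Icc, ← abs_le]
  intro i
  have h1 : v i ^ 2 ≤ m := by
    rw [← (hv : ∑ i, v i ^ 2 = m)]
    exact Finset.single_le_sum (f := fun i => v i ^ 2) (fun _ _ => sq_nonneg _)
      (Finset.mem_univ i)
  have h2 : |v i| ≤ v i ^ 2 := by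
    rw [← sq_abs]
    rcases (abs_nonneg (v i)).eq_or_lt with h | h
    · simp [← h]
    · nlinarith [Int.add_one_le_iff.2 h]
  exact h2.trans h1

instance {ι : Type*} [Fintype ι] (m : ℤ) : Finite {v : ι → ℤ // ∑ i, v i ^ 2 = m} :=
  (finite_sum_sq_eq m).to_subtype

/-- Quadruples of positive odd integers with `a b + c d = 2 m`. -/
def oddQuads (m : ℤ) : Finset ((ℤ × ℤ) × (ℤ × ℤ)) :=
  ((Finset.Icc 1 (2 * m) ×ˢ Finset.Icc 1 (2 * m)) ×ˢ
    (Finset.Icc 1 (2 * m) ×ˢ Finset.Icc 1 (2 * m))).filter fun z =>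
      z.1.1 * z.1.2 + z.2.1 * z.2.2 = 2 * m ∧
        (z.1.1 % 2 = 1 ∧ z.1.2 % 2 = 1) ∧ (z.2.1 % 2 = 1 ∧ z.2.2 % 2 = 1)

lemma mem_oddQuads {m a b c d : ℤ} : ((a, b), (c, d)) ∈ oddQuads m ↔
    (0 < a ∧ 0 < b ∧ 0 < c ∧ 0 < d) ∧ a * b + c * d = 2 * m ∧
      (a % 2 = 1 ∧ b % 2 = 1) ∧ (c % 2 = 1 ∧ d % 2 = 1) := by
  simp only [oddQuads, Finset.mem_filter, Finset.mem_product, Finset.mem_Icc]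
  constructor
  · rintro ⟨⟨⟨h1, h2⟩, h3, h4⟩, h⟩
    exact ⟨⟨by omega, by omega, by omega, by omega⟩, h⟩
  · rintro ⟨⟨ha, hb, hc, hd⟩, h, ho⟩
    refine ⟨⟨⟨⟨by omega, ?_⟩, ⟨by omega, ?_⟩⟩, ⟨⟨by omega, ?_⟩, ⟨by omega, ?_⟩⟩⟩, h, ho⟩ <;>
    nlinarith [mul_pos ha hb, mul_pos hc hd]

/-- The product of the signs of two odd integers modulo `4`. -/
def oddSign (a c : ℤ) : ℤ := if (a - c) % 4 = 0 then 1 else -1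

/-- Dirichlet's involution on the quadruples with `c < a`. -/
def dirichletMap (z : (ℤ × ℤ) × (ℤ × ℤ)) : (ℤ × ℤ) × (ℤ × ℤ) :=
  let k := z.2.1 / (z.1.1 - z.2.1) + 1
  (((k + 1) * z.1.2 + k * z.2.2, (1 - k) * z.1.1 + k * z.2.1),
    (k * z.1.2 + (k - 1) * z.2.2, k * z.1.1 - (k + 1) * z.2.1))

lemma add_mod_four_of_oddQuads {a b c d m : ℤ} (hm : m % 2 = 1) (h : a * b + c * d = 2 * m)
    (ha : a % 2 = 1) (hb : b % 2 = 1) (hc : c % 2 = 1) (hd : d % 2 = 1) :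
    ((a - c) % 4 = 0 ↔ ¬ (b + d) % 4 = 0) := by
  have h1 : (a * b + c * d) % 4 = 2 := by omega
  rw [Int.add_emod, Int.mul_emod a, Int.mul_emod c] at h1
  have ha' : a % 4 = 1 ∨ a % 4 = 3 := by omega
  have hb' : b % 4 = 1 ∨ b % 4 = 3 := by omega
  have hc' : c % 4 = 1 ∨ c % 4 = 3 := by omega
  have hd' : d % 4 = 1 ∨ d % 4 = 3 := by omega
  rcases ha' with h2 | h2 <;> rcases hb' with h3 | h3 <;> rcases hc' with h4 | h4 <;>
    rcases hd' with h5 | h5 <;> rw [h2, h3, h4, h5] at h1 <;> omega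

lemma sum_oddSign_lt {m : ℤ} (hm : m % 2 = 1) :
    ∑ z ∈ (oddQuads m).filter (fun z => z.2.1 < z.1.1), oddSign z.1.1 z.2.1 = 0 := by
  have key : ∀ a b c d : ℤ, ((a, b), (c, d)) ∈ oddQuads m → c < a →
      ∃ k : ℤ, 1 ≤ k ∧ c / (a - c) + 1 = k ∧ 0 < (1 - k) * a + k * c ∧ 0 < k * a - (k + 1) * c := by
    intro a b c d h hca
    obtain ⟨⟨ha, hb, hc, hd⟩, h, ⟨ha', hb'⟩, hc', hd'⟩ := mem_oddQuads.1 h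
    have hpos : 0 < a - c := by omega
    have h1 := Int.mul_ediv_add_emod c (a - c)
    have h2 := Int.emod_nonneg c hpos.ne'
    have h3 := Int.emod_lt_of_pos c hpos
    have h4 : 0 ≤ c / (a - c) := Int.ediv_nonneg hc.le hpos.le
    have h5 : c % (a - c) ≠ 0 := by
      intro h0
      have h6 : (2 : ℤ) ∣ a - c := by omega
      have h7 := h6.trans (Int.dvd_of_emod_eq_zero h0)
      omega
    refine ⟨_, by omega, rfl, ?_, ?_⟩
    · have : 0 < c % (a - c) := by omega
      nlinarith
    · nlinarith
  refine Finset.sum_involution (fun z _ => dirichletMap z) ?_ ?_ ?_ ?_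
  · rintro ⟨⟨a, b⟩, ⟨c, d⟩⟩ hz
    obtain ⟨hz, hca⟩ := Finset.mem_filter.1 hz
    obtain ⟨k, hk1, hk, hb1, hd1⟩ := key a b c d hz hca
    obtain ⟨⟨ha, hb, hc, hd⟩, h, ⟨ha', hb'⟩, hc', hd'⟩ := mem_oddQuads.1 hz
    have h4 := add_mod_four_of_oddQuads hm h ha' hb' hc' hd'
    simp only [dirichletMap, hk, oddSign]
    rw [show (k + 1) * b + k * d - (k * b + (k - 1) * d) = b + d by ring]
    by_cases h0 : (a - c) % 4 = 0
    · rw [if_pos h0, if_neg (h4.1 h0)]; norm_num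
    · rw [if_neg h0, if_pos (by tauto)]; norm_num
  · rintro ⟨⟨a, b⟩, ⟨c, d⟩⟩ hz _ heq
    obtain ⟨hz, hca⟩ := Finset.mem_filter.1 hz
    obtain ⟨k, hk1, hk, hb1, hd1⟩ := key a b c d hz hca
    obtain ⟨⟨ha, hb, hc, hd⟩, h, ⟨ha', hb'⟩, hc', hd'⟩ := mem_oddQuads.1 hz
    have h4 := add_mod_four_of_oddQuads hm h ha' hb' hc' hd'
    simp only [dirichletMap, hk, Prod.mk.injEq] at heq
    obtain ⟨⟨e1, e2⟩, e3, e4⟩ := heq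
    have : b + d = a - c := by linear_combination e1 - e3
    rw [this] at h4
    tauto
  · rintro ⟨⟨a, b⟩, ⟨c, d⟩⟩ hz
    obtain ⟨hz, hca⟩ := Finset.mem_filter.1 hz
    obtain ⟨k, hk1, hk, hb1, hd1⟩ := key a b c d hz hca
    obtain ⟨⟨ha, hb, hc, hd⟩, h, ⟨ha', hb'⟩, hc', hd'⟩ := mem_oddQuads.1 hz
    simp only [dirichletMap, hk]
    rw [Finset.mem_filter, mem_oddQuads]
    refine ⟨⟨⟨by positivity, hb1, ?_, hd1⟩, by linear_combination h, ⟨?_, ?_⟩, ?_, ?_⟩, ?_⟩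
    · nlinarith
    · obtain ⟨b, rfl⟩ : ∃ t, b = 2 * t + 1 := ⟨b / 2, by omega⟩
      obtain ⟨d, rfl⟩ : ∃ t, d = 2 * t + 1 := ⟨d / 2, by omega⟩
      rw [show (k + 1) * (2 * b + 1) + k * (2 * d + 1) = 2 * ((k + 1) * b + k * d + k) + 1 by ring]
      omega
    · obtain ⟨a, rfl⟩ : ∃ t, a = 2 * t + 1 := ⟨a / 2, by omega⟩
      obtain ⟨c, rfl⟩ : ∃ t, c = 2 * t + 1 := ⟨c / 2, by omega⟩
      rw [show (1 - k) * (2 * a + 1) + k * (2 * c + 1) = 2 * ((1 - k) * a + k * c) + 1 by ring]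
      omega
    · obtain ⟨b, rfl⟩ : ∃ t, b = 2 * t + 1 := ⟨b / 2, by omega⟩
      obtain ⟨d, rfl⟩ : ∃ t, d = 2 * t + 1 := ⟨d / 2, by omega⟩
      rw [show k * (2 * b + 1) + (k - 1) * (2 * d + 1) = 2 * (k * b + (k - 1) * d + k - 1) + 1 by
        ring]
      omega
    · obtain ⟨a, rfl⟩ : ∃ t, a = 2 * t + 1 := ⟨a / 2, by omega⟩
      obtain ⟨c, rfl⟩ : ∃ t, c = 2 * t + 1 := ⟨c / 2, by omega⟩
      rw [show k * (2 * a + 1) - (k + 1) * (2 * c + 1) = 2 * (k * a - (k + 1) * c - 1) + 1 by ring]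
      omega
    · change k * b + (k - 1) * d < (k + 1) * b + k * d
      linarith
  · rintro ⟨⟨a, b⟩, ⟨c, d⟩⟩ hz
    obtain ⟨hz, hca⟩ := Finset.mem_filter.1 hz
    obtain ⟨k, hk1, hk, hb1, hd1⟩ := key a b c d hz hca
    obtain ⟨⟨ha, hb, hc, hd⟩, h, ⟨ha', hb'⟩, hc', hd'⟩ := mem_oddQuads.1 hz
    have hk' : (k * b + (k - 1) * d) / ((k + 1) * b + k * d - (k * b + (k - 1) * d)) + 1 = k := by
      rw [show (k + 1) * b + k * d - (k * b + (k - 1) * d) = b + d by ring,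
        show k * b + (k - 1) * d = b + (k - 1) * (b + d) by ring,
        Int.add_mul_ediv_right _ _ (by omega), Int.ediv_eq_zero_of_lt hb.le (by omega)]
      ring
    simp only [dirichletMap, hk, hk']
    simp only [Prod.mk.injEq]
    refine ⟨⟨?_, ?_⟩, ?_, ?_⟩ <;> ring

lemma le_sum_oddSign {m : ℕ} (hm : m % 2 = 1) :
    (m : ℤ) ≤ ∑ z ∈ oddQuads m, oddSign z.1.1 z.2.1 := by
  have hm' : (m : ℤ) % 2 = 1 := by omega
  have hlt := sum_oddSign_lt hm'
  have hgt : ∑ z ∈ (oddQuads m).filter (fun z => z.1.1 < z.2.1), oddSign z.1.1 z.2.1 = 0 := by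
    rw [← hlt]
    refine Finset.sum_bij' (fun z _ => (z.2, z.1)) (fun z _ => (z.2, z.1)) ?_ ?_ ?_ ?_ ?_
    · rintro ⟨⟨a, b⟩, ⟨c, d⟩⟩ hz
      rw [Finset.mem_filter, mem_oddQuads] at hz ⊢
      obtain ⟨⟨⟨ha, hb, hc, hd⟩, h, h1, h2⟩, h3⟩ := hz
      exact ⟨⟨⟨hc, hd, ha, hb⟩, by linarith, h2, h1⟩, h3⟩
    · rintro ⟨⟨a, b⟩, ⟨c, d⟩⟩ hz
      rw [Finset.mem_filter, mem_oddQuads] at hz ⊢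
      obtain ⟨⟨⟨ha, hb, hc, hd⟩, h, h1, h2⟩, h3⟩ := hz
      exact ⟨⟨⟨hc, hd, ha, hb⟩, by linarith, h2, h1⟩, h3⟩
    · intros; rfl
    · intros; rfl
    · rintro ⟨⟨a, b⟩, ⟨c, d⟩⟩ hz
      simp only [oddSign]
      congr 1
      exact propext ⟨fun h => by omega, fun h => by omega⟩
  have hsplit : ∑ z ∈ oddQuads m, oddSign z.1.1 z.2.1 =
      ∑ z ∈ (oddQuads m).filter (fun z => z.2.1 < z.1.1), oddSign z.1.1 z.2.1 +
      ∑ z ∈ (oddQuads m).filter (fun z => z.1.1 < z.2.1), oddSign z.1.1 z.2.1 +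
      ∑ z ∈ (oddQuads m).filter (fun z => z.1.1 = z.2.1), oddSign z.1.1 z.2.1 := by
    rw [Finset.sum_filter, Finset.sum_filter, Finset.sum_filter, ← Finset.sum_add_distrib,
      ← Finset.sum_add_distrib]
    refine Finset.sum_congr rfl fun z _ => ?_
    rcases lt_trichotomy z.1.1 z.2.1 with h | h | h
    · simp [h, h.ne, h.not_gt]
    · simp [h]
    · simp [h, h.ne', h.not_gt]
  rw [hsplit, hlt, hgt, zero_add, zero_add]
  have hone : ∀ z ∈ (oddQuads m).filter (fun z => z.1.1 = z.2.1), oddSign z.1.1 z.2.1 = 1 := by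
    intro z hz
    simp [oddSign, (Finset.mem_filter.1 hz).2]
  rw [Finset.sum_congr rfl hone, Finset.sum_const, nsmul_one]
  have hcard : (Finset.range m).card ≤
      ((oddQuads m).filter (fun z => z.1.1 = z.2.1)).card := by
    refine Finset.card_le_card_of_injOn
      (fun j : ℕ => (((1 : ℤ), 2 * (j : ℤ) + 1), ((1 : ℤ), 2 * (m : ℤ) - (2 * j + 1)))) ?_ ?_
    · intro j hj
      have hj' := Finset.mem_range.1 hj
      simp only [Finset.mem_coe, Finset.mem_filter, mem_oddQuads]
      refine ⟨⟨⟨by norm_num, by omega, by norm_num, by omega⟩, by ring, ⟨by norm_num, by omega⟩,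
        by norm_num, by omega⟩, trivial⟩
    · intro i _ j _ hij
      simp only [Prod.mk.injEq] at hij
      omega
  rw [Finset.card_range] at hcard
  exact_mod_cast hcard

/-- The Gaussian integers of norm `n`. -/
def gaussSphere (n : ℤ) : Finset GaussianInt :=
  ((Finset.Icc (-n) n ×ˢ Finset.Icc (-n) n).image fun z => (⟨z.1, z.2⟩ : GaussianInt)).filter
    fun z => z.norm = n

lemma gaussianInt_norm (z : GaussianInt) : z.norm = z.re ^ 2 + z.im ^ 2 := by
  rw [Zsqrtd.norm_def]; ring

lemma mem_gaussSphere {n : ℤ} {z : GaussianInt} : z ∈ gaussSphere n ↔ z.norm = n := by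
  simp only [gaussSphere, Finset.mem_filter, Finset.mem_image, Finset.mem_product, Finset.mem_Icc,
    and_iff_right_iff_imp]
  intro h
  rw [gaussianInt_norm] at h
  refine ⟨(z.re, z.im), ?_, rfl⟩
  have h1 := Int.le_self_sq z.re
  have h2 := Int.le_self_sq z.im
  have h3 := Int.le_self_sq (-z.re)
  have h4 := Int.le_self_sq (-z.im)
  rw [neg_sq] at h3 h4
  have h5 := sq_nonneg z.re
  have h6 := sq_nonneg z.im
  exact ⟨⟨by linarith, by linarith⟩, ⟨by linarith, by linarith⟩⟩

/-- The nontrivial character modulo `4` as an arithmetic function. -/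
def chiFour : ArithmeticFunction ℤ := ⟨fun n => ZMod.χ₄ (n : ZMod 4), by simp⟩

lemma chiFour_apply (n : ℕ) : chiFour n = ZMod.χ₄ (n : ZMod 4) := rfl

lemma chiFour_isMultiplicative : chiFour.IsMultiplicative := by
  refine ⟨by rw [chiFour_apply, Nat.cast_one, map_one], fun {m n} _ => ?_⟩
  rw [chiFour_apply, Nat.cast_mul, map_mul, chiFour_apply, chiFour_apply]

/-- The divisor sum of the nontrivial character modulo `4`. -/
def chiSum : ArithmeticFunction ℤ := (ArithmeticFunction.zeta : ArithmeticFunction ℕ) * chiFour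

lemma chiSum_apply (n : ℕ) : chiSum n = ∑ d ∈ n.divisors, ZMod.χ₄ (d : ZMod 4) := by
  rw [chiSum, ArithmeticFunction.coe_zeta_mul_apply]; rfl

lemma chiSum_isMultiplicative : chiSum.IsMultiplicative :=
  ArithmeticFunction.isMultiplicative_zeta.natCast.mul chiFour_isMultiplicative

lemma chiSum_prime_pow_of_one {p : ℕ} (hp : p.Prime) (h : p % 4 = 1) (k : ℕ) :
    chiSum (p ^ k) = k + 1 := by
  rw [chiSum_apply, Nat.sum_divisors_prime_pow hp]
  simp only [Nat.cast_pow, map_pow, ZMod.χ₄_nat_one_mod_four h]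
  simp

lemma chiSum_prime_pow_of_three {p : ℕ} (hp : p.Prime) (h : p % 4 = 3) (k : ℕ) :
    chiSum (p ^ k) = if Even k then 1 else 0 := by
  rw [chiSum_apply, Nat.sum_divisors_prime_pow hp]
  simp only [Nat.cast_pow, map_pow, ZMod.χ₄_nat_three_mod_four h]
  induction k with
  | zero => simp
  | succ k ih =>
    rw [Finset.sum_range_succ, ih]
    by_cases hk : Even k
    · simp [hk, Nat.even_add_one, pow_succ]
    · simp [hk, Nat.even_add_one, pow_succ, (Nat.not_even_iff_odd.1 hk).neg_one_pow]

lemma gaussSphere_card_mul_sq (p : ℤ) (hp : p ≠ 0) (n : ℤ) :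
    (gaussSphere n).card ≤ (gaussSphere (p ^ 2 * n)).card := by
  refine Finset.card_le_card_of_injOn (fun z => (p : GaussianInt) * z) ?_ ?_
  · intro z hz
    rw [Finset.mem_coe, mem_gaussSphere] at hz ⊢
    rw [Zsqrtd.norm_mul, hz, Zsqrtd.norm_intCast]; ring
  · intro z _ w _ h
    exact mul_left_cancel₀ (by exact_mod_cast hp) h

lemma gaussSphere_card_mul_pow_of_one {p : ℕ} (hp : p.Prime) (h : p % 4 = 1) {n : ℕ}
    (hn : ¬ p ∣ n) (k : ℕ) :
    (k + 1) * (gaussSphere n).card ≤ (gaussSphere (p ^ k * n)).card := by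
  have := Fact.mk hp
  obtain ⟨a, b, hab⟩ := Nat.Prime.sq_add_sq (p := p) (by omega)
  set π : GaussianInt := ⟨a, b⟩ with hπ
  have hnorm : π.norm = p := by
    rw [gaussianInt_norm]
    change (a : ℤ) ^ 2 + (b : ℤ) ^ 2 = p
    exact_mod_cast hab
  have hirr : ∀ z : GaussianInt, z.norm = p → Irreducible z := by
    intro z hz
    refine ⟨fun hu => ?_, fun x y hxy => ?_⟩
    · rw [← Zsqrtd.norm_eq_one_iff, hz] at hu
      exact hp.one_lt.ne' (by simpa using hu)
    · have h1 : x.norm.natAbs * y.norm.natAbs = p := by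
        rw [← Int.natAbs_mul, ← Zsqrtd.norm_mul, ← hxy, hz]; simp
      rw [← Zsqrtd.norm_eq_one_iff, ← Zsqrtd.norm_eq_one_iff]
      rcases Nat.prime_mul_iff.1 (h1 ▸ hp) with h2 | h2
      · exact Or.inr h2.2
      · exact Or.inl h2.2
  have hprime : Prime π := (hirr π hnorm).prime
  have hstar : (star π).norm = p := by rw [Zsqrtd.norm_conj, hnorm]
  have h0 : star π ≠ 0 := (hirr _ hstar).ne_zero
  have hdvd : ¬ π ∣ star π := by
    rintro hd
    have hd2 : π ∣ ((2 * a : ℤ) : GaussianInt) := by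
      have : ((2 * a : ℤ) : GaussianInt) = π + star π := by
        ext <;> simp [hπ]; ring
      rw [this]; exact dvd_add dvd_rfl hd
    obtain ⟨w, hw⟩ := hd2
    have h3 := congrArg Zsqrtd.norm hw
    rw [Zsqrtd.norm_mul, hnorm, Zsqrtd.norm_intCast] at h3
    have h4 : (p : ℤ) ∣ 2 * a * (2 * a) := ⟨_, h3⟩
    have h5 : p ∣ 2 * a * (2 * a) := by exact_mod_cast h4
    have h6 : p ∣ a := by
      have h7 : p ∣ 2 * a := by rcases hp.dvd_mul.1 h5 with h | h <;> exact h
      rcases hp.dvd_mul.1 h7 with h | h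
      · have := Nat.le_of_dvd (by norm_num) h
        have := hp.two_le
        omega
      · exact h
    have h8 : 0 < a := by
      rcases Nat.eq_zero_or_pos a with h | h
      · exfalso
        rw [h] at hab
        refine hp.prime.irreducible.not_isSquare ⟨b, ?_⟩
        rw [← hab]; ring
      · exact h
    have h9 := Nat.le_of_dvd h8 h6
    have := hp.two_le
    nlinarith
  have key : ∀ i j : ℕ, i < j → j ≤ k → ∀ z w : GaussianInt, z.norm = n →
      π ^ i * star π ^ (k - i) * z ≠ π ^ j * star π ^ (k - j) * w := by
    intro i j hij hjk z w hz he
    obtain ⟨s, rfl⟩ := Nat.exists_eq_add_of_lt hij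
    have h1 : k - i = (k - (i + s + 1)) + (s + 1) := by omega
    rw [h1] at he
    have h2 : (π ^ i * star π ^ (k - (i + s + 1))) * (star π ^ (s + 1) * z) =
        (π ^ i * star π ^ (k - (i + s + 1))) * (π * (π ^ s * w)) := by
      rw [pow_add (star π)] at he
      linear_combination he
    have h3 := mul_left_cancel₀ (mul_ne_zero (pow_ne_zero _ hprime.ne_zero) (pow_ne_zero _ h0)) h2
    rcases hprime.dvd_or_dvd (Dvd.intro _ h3.symm) with h4 | h4
    · exact hdvd (hprime.dvd_of_dvd_pow h4)
    · obtain ⟨v, rfl⟩ := h4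
      rw [Zsqrtd.norm_mul, hnorm] at hz
      exact hn (by exact_mod_cast (Dvd.intro _ hz : (p : ℤ) ∣ n))
  have hcard : (k + 1) * (gaussSphere n).card = (Finset.range (k + 1) ×ˢ gaussSphere n).card := by
    simp
  rw [hcard]
  refine Finset.card_le_card_of_injOn (fun x => π ^ x.1 * star π ^ (k - x.1) * x.2) ?_ ?_
  · rintro ⟨i, z⟩ hz
    simp only [Finset.coe_product, Set.mem_prod, Finset.mem_coe, Finset.mem_range,
      mem_gaussSphere] at hz ⊢
    have hpow : ∀ (x : GaussianInt) (i : ℕ), (x ^ i).norm = x.norm ^ i :=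
      fun x i => map_pow (Zsqrtd.normMonoidHom (d := -1)) x i
    rw [Zsqrtd.norm_mul, Zsqrtd.norm_mul, hpow, hpow, hnorm, hstar, hz.2, ← pow_add]
    congr 2; omega
  · rintro ⟨i, z⟩ hz ⟨j, w⟩ hw he
    simp only [Finset.coe_product, Set.mem_prod, Finset.mem_coe, Finset.mem_range,
      mem_gaussSphere] at hz hw he
    rcases lt_trichotomy i j with hij | hij | hij
    · exact absurd he (key i j hij (by omega) z w hz.2)
    · subst hij
      rw [mul_left_cancel₀ (mul_ne_zero (pow_ne_zero _ hprime.ne_zero) (pow_ne_zero _ h0)) he]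
    · exact absurd he.symm (key j i hij (by omega) w z hw.2)

lemma four_mul_chiSum_le (n : ℕ) : n % 2 = 1 →
    0 ≤ chiSum n ∧ 4 * chiSum n ≤ (gaussSphere n).card := by
  induction n using Nat.recOnPrimePow with
  | zero => simp
  | one =>
    intro _
    rw [chiSum_isMultiplicative.map_one]
    refine ⟨by norm_num, ?_⟩
    have : ({1, -1, ⟨0, 1⟩, ⟨0, -1⟩} : Finset GaussianInt) ⊆ gaussSphere 1 := by
      intro z hz
      rw [mem_gaussSphere, gaussianInt_norm]
      simp only [Finset.mem_insert, Finset.mem_singleton] at hz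
      rcases hz with rfl | rfl | rfl | rfl <;> simp
    have h := Finset.card_le_card this
    have h2 : ({1, -1, ⟨0, 1⟩, ⟨0, -1⟩} : Finset GaussianInt).card = 4 := by decide
    rw [h2] at h
    exact_mod_cast h
  | prime_pow_mul a p k hp hpa hk ih =>
    intro hodd
    have hodd' : Odd (p ^ k * a) := Nat.odd_iff.2 hodd
    obtain ⟨hpk, ha⟩ := Nat.odd_mul.1 hodd'
    have hpo : Odd p := (Nat.odd_pow_iff hk.ne').1 hpk
    obtain ⟨h0, h1⟩ := ih (Nat.odd_iff.1 ha)
    rw [chiSum_isMultiplicative.map_mul_of_coprime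
      (((Nat.Prime.coprime_iff_not_dvd hp).2 hpa).pow_left k)]
    rcases Nat.odd_mod_four_iff.1 (Nat.odd_iff.1 hpo) with h | h
    · rw [chiSum_prime_pow_of_one hp h]
      refine ⟨by positivity, ?_⟩
      have h2 := gaussSphere_card_mul_pow_of_one hp h hpa k
      push_cast at h2 ⊢
      have h3 : ((k : ℤ) + 1) * (gaussSphere a).card ≤ (gaussSphere (p ^ k * a)).card := by
        exact_mod_cast h2
      nlinarith
    · rw [chiSum_prime_pow_of_three hp h]
      split_ifs with hk2
      · obtain ⟨j, rfl⟩ := hk2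
        refine ⟨by simpa using h0, ?_⟩
        have h2 := gaussSphere_card_mul_sq ((p : ℤ) ^ j) (by exact_mod_cast (pow_pos hp.pos j).ne') a
        rw [one_mul]
        refine h1.trans ?_
        have : (((p ^ (j + j) * a : ℕ)) : ℤ) = ((p : ℤ) ^ j) ^ 2 * a := by push_cast; ring
        rw [this]
        exact_mod_cast h2
      · simp

lemma sum_oddSign_eq (m : ℕ) : ∑ z ∈ oddQuads m, oddSign z.1.1 z.2.1 =
    ∑ n ∈ (Finset.range (2 * m)).filter (fun n => n % 2 = 1), chiSum n * chiSum (2 * m - n) := by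
  have h1 : ∀ n, chiSum n = ∑ x ∈ n.divisorsAntidiagonal, ZMod.χ₄ (x.1 : ZMod 4) := by
    intro n
    rw [chiSum_apply, Nat.sum_divisorsAntidiagonal fun i _ => ZMod.χ₄ (i : ZMod 4)]
  simp only [h1, Finset.sum_mul_sum, ← Finset.sum_product']
  rw [Finset.sum_sigma']
  symm
  refine Finset.sum_nbij
    (fun x => (((x.2.1.1 : ℤ), (x.2.1.2 : ℤ)), ((x.2.2.1 : ℤ), (x.2.2.2 : ℤ)))) ?_ ?_ ?_ ?_
  · rintro ⟨n, ⟨a, b⟩, c, d⟩ h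
    simp only [Finset.mem_sigma, Finset.mem_filter, Finset.mem_range, Finset.mem_product,
      Nat.mem_divisorsAntidiagonal] at h
    obtain ⟨⟨h1, h2⟩, ⟨rfl, h4⟩, h5, h6⟩ := h
    have h7 : a * b + c * d = 2 * m := by omega
    have h8 : c * d % 2 = 1 := by omega
    rw [← Nat.odd_iff, Nat.odd_mul, Nat.odd_iff, Nat.odd_iff] at h2 h8
    rw [mem_oddQuads]
    refine ⟨⟨?_, ?_, ?_, ?_⟩, by exact_mod_cast h7, ⟨?_, ?_⟩, ?_, ?_⟩ <;> dsimp only <;> omega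
  · rintro ⟨n, ⟨a, b⟩, c, d⟩ h ⟨n', ⟨a', b'⟩, c', d'⟩ h' he
    simp only [Finset.coe_sigma, Set.mem_sigma_iff, Finset.mem_coe, Finset.mem_filter,
      Finset.mem_range, Finset.mem_product, Nat.mem_divisorsAntidiagonal] at h h'
    simp only [Prod.mk.injEq, Nat.cast_inj] at he
    obtain ⟨⟨rfl, rfl⟩, rfl, rfl⟩ := he
    obtain rfl : n = n' := h.2.1.1.symm.trans h'.2.1.1
    rfl
  · rintro ⟨⟨a, b⟩, c, d⟩ h
    rw [Finset.mem_coe, mem_oddQuads] at h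
    obtain ⟨⟨ha, hb, hc, hd⟩, h, ⟨ha', hb'⟩, hc', hd'⟩ := h
    lift a to ℕ using ha.le
    lift b to ℕ using hb.le
    lift c to ℕ using hc.le
    lift d to ℕ using hd.le
    refine ⟨⟨a * b, (a, b), (c, d)⟩, ?_, rfl⟩
    have h7 : a * b + c * d = 2 * m := by exact_mod_cast h
    have h8 : 0 < c * d := Nat.mul_pos (by omega) (by omega)
    have h9 : 0 < a * b := Nat.mul_pos (by omega) (by omega)
    have h10 : a * b % 2 = 1 := by
      rw [← Nat.odd_iff, Nat.odd_mul, Nat.odd_iff, Nat.odd_iff]; omega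
    simp only [Finset.coe_sigma, Set.mem_sigma_iff, Finset.mem_coe, Finset.mem_filter,
      Finset.mem_range, Finset.mem_product, Nat.mem_divisorsAntidiagonal]
    refine ⟨⟨?_, h10⟩, ⟨trivial, ?_⟩, ?_, ?_⟩ <;> omega
  · rintro ⟨n, ⟨a, b⟩, c, d⟩ h
    simp only [Finset.mem_sigma, Finset.mem_filter, Finset.mem_range, Finset.mem_product,
      Nat.mem_divisorsAntidiagonal] at h
    obtain ⟨⟨h1, h2⟩, ⟨rfl, h4⟩, h5, h6⟩ := h
    have h8 : c * d % 2 = 1 := by omega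
    rw [← Nat.odd_iff, Nat.odd_mul, Nat.odd_iff, Nat.odd_iff] at h2 h8
    simp only [ZMod.χ₄_nat_eq_if_mod_four, oddSign]
    have ha : a % 4 = 1 ∨ a % 4 = 3 := by omega
    have hc : c % 4 = 1 ∨ c % 4 = 3 := by omega
    rcases ha with ha | ha <;> rcases hc with hc | hc <;>
      simp [h2.1, h8.1, ha, hc] <;> omega

/-- Pairs of Gaussian integers of odd norms summing to `2 m`, indexed by the first norm. -/
def oddPairs (m : ℕ) : Finset (Σ _ : ℕ, GaussianInt × GaussianInt) :=
  ((Finset.range (2 * m)).filter (fun n => n % 2 = 1)).sigma fun n =>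
    gaussSphere n ×ˢ gaussSphere ((2 * m - n : ℕ) : ℤ)

lemma mem_oddPairs {m n : ℕ} {z w : GaussianInt} : ⟨n, z, w⟩ ∈ oddPairs m ↔
    (n < 2 * m ∧ n % 2 = 1) ∧ z.norm = n ∧ w.norm = 2 * m - n := by
  simp only [oddPairs, Finset.mem_sigma, Finset.mem_filter, Finset.mem_range, Finset.mem_product,
    mem_gaussSphere]
  constructor
  · rintro ⟨h1, h2, h3⟩
    exact ⟨h1, h2, by rw [h3]; omega⟩
  · rintro ⟨h1, h2, h3⟩
    exact ⟨h1, h2, by rw [h3]; omega⟩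

lemma card_oddPairs {m : ℕ} (hm : m % 2 = 1) : 16 * m ≤ (oddPairs m).card := by
  have h := le_sum_oddSign hm
  rw [sum_oddSign_eq] at h
  zify
  rw [oddPairs, Finset.card_sigma]
  push_cast
  calc (16 * m : ℤ) ≤ ∑ n ∈ (Finset.range (2 * m)).filter (fun n => n % 2 = 1),
        16 * (chiSum n * chiSum (2 * m - n)) := by
        rw [← Finset.mul_sum]; linarith
    _ ≤ _ := by
      refine Finset.sum_le_sum fun n hn => ?_
      rw [Finset.mem_filter, Finset.mem_range] at hn
      obtain ⟨h1, h2⟩ := four_mul_chiSum_le n hn.2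
      obtain ⟨h3, h4⟩ := four_mul_chiSum_le (2 * m - n) (by omega)
      rw [Finset.card_product]
      push_cast
      nlinarith [mul_le_mul h2 h4 (by positivity) (by positivity)]

lemma norm_emod_two (z : GaussianInt) : z.norm % 2 = (z.re + z.im) % 2 := by
  rw [gaussianInt_norm, Int.add_emod, Int.add_emod z.re, sq, sq, Int.mul_emod, Int.mul_emod z.im]
  rcases Int.emod_two_eq_zero_or_one z.re with h | h <;>
    rcases Int.emod_two_eq_zero_or_one z.im with h' | h' <;> rw [h, h'] <;> norm_num

/-- The half sums and half differences of the coordinates. -/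
def halfMap (z w : GaussianInt) : Fin 4 → ℤ :=
  ![(z.re + w.re) / 2, (z.re - w.re) / 2, (z.im + w.im) / 2, (z.im - w.im) / 2]

lemma sum_halfMap_sq {z w : GaussianInt} (h1 : z.re % 2 = w.re % 2) (h2 : z.im % 2 = w.im % 2) :
    2 * ∑ i, halfMap z w i ^ 2 = z.norm + w.norm := by
  rw [Fin.sum_univ_four, gaussianInt_norm, gaussianInt_norm]
  change 2 * (((z.re + w.re) / 2) ^ 2 + ((z.re - w.re) / 2) ^ 2 + ((z.im + w.im) / 2) ^ 2 +
    ((z.im - w.im) / 2) ^ 2) = _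
  obtain ⟨a, ha⟩ : ∃ a, z.re + w.re = 2 * a := ⟨(z.re + w.re) / 2, by omega⟩
  obtain ⟨b, hb⟩ : ∃ b, z.re - w.re = 2 * b := ⟨(z.re - w.re) / 2, by omega⟩
  obtain ⟨c, hc⟩ : ∃ c, z.im + w.im = 2 * c := ⟨(z.im + w.im) / 2, by omega⟩
  obtain ⟨d, hd⟩ : ∃ d, z.im - w.im = 2 * d := ⟨(z.im - w.im) / 2, by omega⟩
  rw [ha, hb, hc, hd]
  simp only [Int.mul_ediv_cancel_left _ (by norm_num : (2 : ℤ) ≠ 0)]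
  obtain ⟨e1, e2, e3, e4⟩ : z.re = a + b ∧ w.re = a - b ∧ z.im = c + d ∧ w.im = c - d := by omega
  rw [e1, e2, e3, e4]
  ring

lemma halfMap_inj {z w z' w' : GaussianInt} (h1 : z.re % 2 = w.re % 2) (h2 : z.im % 2 = w.im % 2)
    (h1' : z'.re % 2 = w'.re % 2) (h2' : z'.im % 2 = w'.im % 2)
    (h : halfMap z w = halfMap z' w') : z = z' ∧ w = w' := by
  have e0 : (z.re + w.re) / 2 = (z'.re + w'.re) / 2 := congrFun h 0
  have e1 : (z.re - w.re) / 2 = (z'.re - w'.re) / 2 := congrFun h 1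
  have e2 : (z.im + w.im) / 2 = (z'.im + w'.im) / 2 := congrFun h 2
  have e3 : (z.im - w.im) / 2 = (z'.im - w'.im) / 2 := congrFun h 3
  exact ⟨Zsqrtd.ext (by omega) (by omega), Zsqrtd.ext (by omega) (by omega)⟩

/-- Jacobi's lower bound for the number of representations as a sum of four squares. -/
lemma eight_mul_le_rep_four {m : ℕ} (hm : m % 2 = 1) : 8 * m ≤ rep 4 m := by
  classical
  set P : (Σ _ : ℕ, GaussianInt × GaussianInt) → Prop := fun x => x.2.1.re % 2 = x.2.2.re % 2
  have h1 := Finset.card_filter_add_card_filter_not (s := oddPairs m) P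
  have h2 : ((oddPairs m).filter fun x => ¬ P x).card ≤ ((oddPairs m).filter P).card := by
    refine Finset.card_le_card_of_injOn (fun x => ⟨x.1, x.2.1, ⟨x.2.2.im, x.2.2.re⟩⟩) ?_ ?_
    · rintro ⟨n, z, w⟩ h
      simp only [Finset.coe_filter, Set.mem_ofPred_eq, mem_oddPairs, P] at h ⊢
      obtain ⟨⟨h1, h2, h3⟩, h4⟩ := h
      have h5 := norm_emod_two w
      refine ⟨⟨h1, h2, ?_⟩, ?_⟩
      · rw [← h3, gaussianInt_norm, gaussianInt_norm]; ring
      · have h4 : ¬ z.re % 2 = w.re % 2 := h4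
        change z.re % 2 = w.im % 2
        omega
    · rintro ⟨n, z, ⟨a, b⟩⟩ h ⟨n', z', ⟨a', b'⟩⟩ h' he
      simp only [Sigma.mk.injEq, Zsqrtd.mk.injEq, heq_eq_eq, Prod.mk.injEq] at he ⊢
      tauto
  have h3 : ((oddPairs m).filter P).card ≤ rep 4 m := by
    rw [← Nat.card_eq_finsetCard, rep]
    have hpar : ∀ n z w, ⟨n, z, w⟩ ∈ (oddPairs m).filter P →
        z.re % 2 = w.re % 2 ∧ z.im % 2 = w.im % 2 := by
      intro n z w h
      rw [Finset.mem_filter, mem_oddPairs] at h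
      obtain ⟨⟨h1, h2, h3⟩, h4⟩ := h
      have h4 : z.re % 2 = w.re % 2 := h4
      have h5 := norm_emod_two w
      have h6 := norm_emod_two z
      exact ⟨h4, by omega⟩
    have hsum : ∀ x : (oddPairs m).filter P, ∑ i, halfMap x.1.2.1 x.1.2.2 i ^ 2 = (m : ℤ) := by
      rintro ⟨⟨n, z, w⟩, h⟩
      have h0 := sum_halfMap_sq (hpar n z w h).1 (hpar n z w h).2
      rw [Finset.mem_filter, mem_oddPairs] at h
      rw [h.1.2.1, h.1.2.2] at h0
      linarith
    refine Nat.card_le_card_of_injective (fun x => ⟨_, hsum x⟩) ?_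
    rintro ⟨⟨n, z, w⟩, h⟩ ⟨⟨n', z', w'⟩, h'⟩ he
    obtain ⟨rfl, rfl⟩ := halfMap_inj (hpar n z w h).1 (hpar n z w h).2 (hpar n' z' w' h').1
      (hpar n' z' w' h').2 (congrArg Subtype.val he)
    rw [Finset.mem_filter, mem_oddPairs] at h h'
    obtain rfl : n = n' := by
      have h8 := h.1.2.1.symm.trans h'.1.2.1
      exact_mod_cast h8
    rfl
  have := card_oddPairs hm
  omega

lemma sum_rep_le_rep_succ (k : ℕ) (m : ℤ) (S : Finset ℤ) :
    ∑ a ∈ S, rep k (m - a ^ 2) ≤ rep (k + 1) m := by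
  have h : Nat.card (Σ a : S, {v : Fin k → ℤ // ∑ i, v i ^ 2 = m - (a : ℤ) ^ 2}) =
      ∑ a ∈ S, rep k (m - a ^ 2) := by
    rw [Nat.card_sigma]
    exact Finset.sum_coe_sort S fun a => rep k (m - a ^ 2)
  rw [← h]
  refine Nat.card_le_card_of_injective
    (fun x => ⟨Fin.cons x.1.1 x.2.1, by rw [Fin.sum_univ_succ]; simp [x.2.2]⟩) ?_
  rintro ⟨⟨a, ha⟩, v, hv⟩ ⟨⟨b, hb⟩, w, hw⟩ he
  have he' : (Fin.cons a v : Fin (k + 1) → ℤ) = Fin.cons b w := congrArg Subtype.val he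
  obtain ⟨rfl, rfl⟩ := Fin.cons_injective2 he'
  rfl

lemma rep_succ_le (k : ℕ) {m : ℤ} {T : ℕ} (hT : m ≤ (T : ℤ) ^ 2) :
    rep (k + 1) m ≤ ∑ a ∈ Finset.Icc (-(T : ℤ)) T, rep k (m - a ^ 2) := by
  set S := Finset.Icc (-(T : ℤ)) T
  have h : Nat.card (Σ a : S, {v : Fin k → ℤ // ∑ i, v i ^ 2 = m - (a : ℤ) ^ 2}) =
      ∑ a ∈ S, rep k (m - a ^ 2) := by
    rw [Nat.card_sigma]
    exact Finset.sum_coe_sort S fun a => rep k (m - a ^ 2)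
  rw [← h]
  have hsum : ∀ x : {v : Fin (k + 1) → ℤ // ∑ i, v i ^ 2 = m},
      ∑ i, Fin.tail x.1 i ^ 2 = m - x.1 0 ^ 2 := by
    intro x
    have := x.2
    rw [Fin.sum_univ_succ] at this
    simp only [Fin.tail]
    linarith
  have hmem : ∀ x : {v : Fin (k + 1) → ℤ // ∑ i, v i ^ 2 = m}, x.1 0 ∈ S := by
    intro x
    have h2 : 0 ≤ ∑ i, Fin.tail x.1 i ^ 2 := Finset.sum_nonneg fun i _ => sq_nonneg _
    have h3 := hsum x
    rw [Finset.mem_Icc, ← abs_le]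
    exact abs_le_of_sq_le_sq (by linarith) (by positivity)
  refine Nat.card_le_card_of_injective (fun x => ⟨⟨x.1 0, hmem x⟩, Fin.tail x.1, hsum x⟩) ?_
  rintro ⟨v, hv⟩ ⟨w, hw⟩ he
  have h1 : v 0 = w 0 := by
    have := congrArg (fun y => (y.1 : ℤ)) he
    exact this
  have h2 : Fin.tail v = Fin.tail w := by
    have := congrArg (fun y => (y.2.1 : Fin k → ℤ)) he
    exact this
  refine Subtype.ext ?_
  change v = w
  rw [← Fin.cons_self_tail v, ← Fin.cons_self_tail w, h1, h2]

lemma rep_eq_zero_of_neg (k : ℕ) {m : ℤ} (hm : m < 0) : rep k m = 0 := by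
  have : IsEmpty {v : Fin k → ℤ // ∑ i, v i ^ 2 = m} :=
    ⟨fun v => by have := Finset.sum_nonneg fun i (_ : i ∈ Finset.univ) => sq_nonneg (v.1 i)
                 have := v.2
                 omega⟩
  exact Nat.card_of_isEmpty

lemma one_le_rep_five (m : ℕ) : 1 ≤ rep 5 m := by
  obtain ⟨a, b, c, d, h⟩ := Nat.sum_four_squares m
  have : Nonempty {v : Fin 5 → ℤ // ∑ i, v i ^ 2 = (m : ℤ)} :=
    ⟨⟨![a, b, c, d, 0], by simp [Fin.sum_univ_five]; exact_mod_cast h⟩⟩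
  exact Nat.card_pos

lemma rep_five_lower (m : ℕ) : (Nat.sqrt m + 1) ^ 3 ≤ 8 * rep 5 m := by
  set s := Nat.sqrt m with hs
  have hs1 : s * s ≤ m := Nat.sqrt_le m
  rcases Nat.lt_or_ge s 2 with h | h
  · have := one_le_rep_five m
    interval_cases s <;> omega
  · set T := s / 2
    set e : ℤ := (m + 1 : ℤ) % 2 with he
    set S : Finset ℤ := (Finset.range T).image fun j : ℕ => 2 * (j : ℤ) - T + (T + e) % 2 with hS
    have hcard : S.card = T := by
      rw [hS, Finset.card_image_of_injective _ (fun a b hab => by simpa using hab),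
        Finset.card_range]
    have hT : 1 ≤ T := by omega
    have hTs : 2 * T ≤ s := by omega
    have key : ∀ a ∈ S, 6 * m ≤ rep 4 (m - a ^ 2) := by
      intro a ha
      obtain ⟨j, hj, rfl⟩ := Finset.mem_image.1 ha
      rw [Finset.mem_range] at hj
      set a := 2 * (j : ℤ) - T + (T + e) % 2 with ha'
      have h1 : |a| ≤ T := by rw [abs_le]; omega
      have h2 : a ^ 2 ≤ (T : ℤ) ^ 2 := by rw [← sq_abs]; gcongr
      have h3 : 4 * T ^ 2 ≤ m := by nlinarith
      have h3' : 4 * (T : ℤ) ^ 2 ≤ m := by exact_mod_cast h3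
      have h4 : a % 2 = e % 2 := by omega
      have h5 : (m - a ^ 2) % 2 = 1 := by
        rw [sq, Int.sub_emod, Int.mul_emod, h4]
        have : e = 0 ∨ e = 1 := by omega
        rcases this with h | h <;> rw [h] <;> norm_num <;> omega
      obtain ⟨n, hn⟩ := Int.eq_ofNat_of_zero_le (show 0 ≤ m - a ^ 2 by nlinarith)
      rw [hn]
      have := eight_mul_le_rep_four (m := n) (by omega)
      have : 3 * m ≤ 4 * n := by zify; linarith
      omega
    have h1 := sum_rep_le_rep_succ 4 m S
    have h2 := Finset.card_nsmul_le_sum S _ _ key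
    rw [hcard, smul_eq_mul] at h2
    have h3 : s + 1 ≤ 4 * T := by omega
    have h4 : (s + 1) ^ 3 ≤ 4 * T * (12 * m) := by
      rw [pow_succ, mul_comm]
      refine Nat.mul_le_mul h3 ?_
      nlinarith
    nlinarith

lemma rep_lower (K : ℕ) (hK : 5 ≤ K) :
    ∃ C : ℕ, ∀ m : ℕ, (Nat.sqrt m + 1) ^ (K - 2) ≤ C * rep K m := by
  induction K, hK using Nat.le_induction with
  | base => exact ⟨8, rep_five_lower⟩
  | succ K hK ih =>
    obtain ⟨C, hC⟩ := ih
    refine ⟨4 ^ (K - 1) * C, fun m => ?_⟩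
    set s := Nat.sqrt m with hs
    have hs1 : s * s ≤ m := Nat.sqrt_le m
    set T := s / 2
    have hexp : K + 1 - 2 = K - 2 + 1 := by omega
    have hexp' : K - 1 = K - 2 + 1 := by omega
    have key : ∀ a ∈ Finset.Icc (-(T : ℤ)) T, (T + 1) ^ (K - 2) ≤ C * rep K (m - a ^ 2) := by
      intro a ha
      rw [Finset.mem_Icc, ← abs_le] at ha
      have h2 : a ^ 2 ≤ (T : ℤ) ^ 2 := by rw [← sq_abs]; gcongr
      have hTs : 2 * T ≤ s := by omega
      have h3 : 4 * T ^ 2 ≤ m := by nlinarith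
      have h3' : 4 * (T : ℤ) ^ 2 ≤ m := by exact_mod_cast h3
      obtain ⟨n, hn⟩ := Int.eq_ofNat_of_zero_le (show 0 ≤ m - a ^ 2 by nlinarith)
      rw [hn]
      refine le_trans (Nat.pow_le_pow_left ?_ _) (hC n)
      have : T ≤ Nat.sqrt n := by
        rw [Nat.le_sqrt]
        zify
        nlinarith
      omega
    have h1 := sum_rep_le_rep_succ K m (Finset.Icc (-(T : ℤ)) T)
    have h2 := Finset.card_nsmul_le_sum _ _ _ key
    have hcard : (Finset.Icc (-(T : ℤ)) T).card = 2 * T + 1 := by simp; omega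
    rw [hcard, smul_eq_mul, ← Finset.mul_sum] at h2
    calc (s + 1) ^ (K + 1 - 2) ≤ (2 * (T + 1)) ^ (K + 1 - 2) := Nat.pow_le_pow_left (by omega) _
      _ = 2 ^ (K - 1) * ((T + 1) * (T + 1) ^ (K - 2)) := by
        rw [hexp, hexp', mul_pow, pow_succ (T + 1)]; ring
      _ ≤ 4 ^ (K - 1) * ((2 * T + 1) * (T + 1) ^ (K - 2)) := by
        gcongr <;> omega
      _ ≤ 4 ^ (K - 1) * (C * ∑ a ∈ Finset.Icc (-(T : ℤ)) T, rep K (m - a ^ 2)) := by gcongr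
      _ ≤ 4 ^ (K - 1) * (C * rep (K + 1) m) := by gcongr
      _ = _ := by ring

/-- A slowly decaying summable kernel on the integers, of width `z`. -/
def tailKernel (z : ℝ) (k : ℤ) : ℝ := √(z / (z + |(k : ℝ)|)) ^ 3

lemma tailKernel_nonneg (z : ℝ) (k : ℤ) : 0 ≤ tailKernel z k := by
  unfold tailKernel; positivity

lemma tailKernel_le_one {z : ℝ} (hz : 0 < z) (k : ℤ) : tailKernel z k ≤ 1 := by
  unfold tailKernel
  refine pow_le_one₀ (Real.sqrt_nonneg _) (Real.sqrt_le_one.2 ?_)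
  rw [div_le_one (by positivity)]
  linarith [abs_nonneg (k : ℝ)]

lemma tailKernel_step {z : ℝ} (hz : 0 < z) (n : ℕ) :
    tailKernel z (n + 1) ≤ 2 * √z ^ 3 * (1 / √(z + n) - 1 / √(z + (n + 1))) := by
  unfold tailKernel
  have h0 : |(((n : ℤ) + 1 : ℤ) : ℝ)| = (n : ℝ) + 1 := by
    push_cast; exact abs_of_nonneg (by positivity)
  rw [h0, Real.sqrt_div hz.le, div_pow, mul_assoc, mul_comm 2, mul_assoc, div_eq_mul_inv]
  refine mul_le_mul_of_nonneg_left ?_ (by positivity)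
  set A := √(z + n)
  set B := √(z + (n + 1))
  have hA : 0 < A := Real.sqrt_pos.2 (by positivity)
  have hB : 0 < B := Real.sqrt_pos.2 (by positivity)
  have hAB : A ≤ B := Real.sqrt_le_sqrt (by linarith)
  have h1 : B ^ 2 - A ^ 2 = 1 := by
    rw [Real.sq_sqrt (by positivity), Real.sq_sqrt (by positivity)]; ring
  have h2 : A * (A + B) ≤ 2 * B ^ 2 := by nlinarith
  rw [div_sub_div _ _ hA.ne' hB.ne', inv_eq_one_div, ← mul_comm 2, ← mul_div_assoc,
    div_le_div_iff₀ (by positivity) (by positivity)]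
  have h3 : A * B * (A + B) ≤ 2 * B ^ 3 * ((B - A) * (B + A)) := by
    have : (B - A) * (B + A) = 1 := by linarith
    rw [this]; nlinarith
  have h4 : A * B ≤ 2 * B ^ 3 * (B - A) := by
    refine le_of_mul_le_mul_right (?_ : _ * (A + B) ≤ _ * (A + B)) (by positivity)
    linarith
  linarith

lemma sum_tailKernel_Icc {z : ℝ} (hz : 0 < z) (n : ℕ) :
    ∑ k ∈ Finset.Icc (-(n : ℤ)) n, tailKernel z k ≤ 1 + 4 * z - 4 * √z ^ 3 * (1 / √(z + n)) := by
  induction n with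
  | zero =>
    have h1 : √z ^ 3 = z * √z := by rw [pow_succ, Real.sq_sqrt hz.le]
    have h2 : 0 < √z := Real.sqrt_pos.2 hz
    have h3 : 4 * (z * √z) * (1 / √z) = 4 * z := by field_simp
    simp only [CharP.cast_eq_zero, neg_zero, Finset.Icc_self, Finset.sum_singleton, add_zero]
    rw [h1, h3]
    linarith [tailKernel_le_one hz 0]
  | succ n ih =>
    have h1 : Finset.Icc (-((n + 1 : ℕ) : ℤ)) ((n + 1 : ℕ) : ℤ) =
        insert (-((n : ℤ) + 1)) (insert ((n : ℤ) + 1) (Finset.Icc (-(n : ℤ)) n)) := by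
      ext k; simp only [Finset.mem_Icc, Finset.mem_insert]; omega
    have h2 : tailKernel z (-((n : ℤ) + 1)) = tailKernel z ((n : ℤ) + 1) := by
      unfold tailKernel; push_cast; rw [abs_neg]
    rw [h1, Finset.sum_insert (by simp; omega), Finset.sum_insert (by simp), h2]
    have := tailKernel_step hz n
    push_cast
    linarith

lemma sum_tailKernel_le {z : ℝ} (hz : 0 < z) (F : Finset ℤ) :
    ∑ k ∈ F, tailKernel z k ≤ 1 + 4 * z := by
  set n := ∑ k ∈ F, k.natAbs
  have h : F ⊆ Finset.Icc (-(n : ℤ)) n := by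
    intro k hk
    have := Finset.single_le_sum (f := fun k : ℤ => k.natAbs) (fun _ _ => Nat.zero_le _) hk
    rw [Finset.mem_Icc]
    have h2 : k.natAbs ≤ n := this
    omega
  refine (Finset.sum_le_sum_of_subset_of_nonneg h fun _ _ _ => tailKernel_nonneg _ _).trans
    ((sum_tailKernel_Icc hz n).trans ?_)
  have : 0 ≤ 4 * √z ^ 3 * (1 / √(z + n)) := by positivity
  linarith

lemma inv_sq_le_tailKernel {z : ℝ} (hz : 0 < z) (k : ℤ) :
    ((1 + |(k : ℝ)| / z) ^ 2)⁻¹ ≤ tailKernel z k := by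
  have h1 : 1 + |(k : ℝ)| / z = (z / (z + |(k : ℝ)|))⁻¹ := by field_simp
  rw [h1, inv_pow, inv_inv, tailKernel]
  set t := z / (z + |(k : ℝ)|)
  have ht : 0 ≤ t := by positivity
  have ht1 : t ≤ 1 := by
    refine (div_le_one (by positivity)).2 ?_
    linarith [abs_nonneg (k : ℝ)]
  calc t ^ 2 = √t ^ 4 := by rw [show 4 = 2 * 2 by norm_num, pow_mul, Real.sq_sqrt ht]
    _ ≤ √t ^ 3 := pow_le_pow_of_le_one (Real.sqrt_nonneg _) (Real.sqrt_le_one.2 ht1) (by norm_num)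

/-- The sum of a bump over an arithmetic progression of step `η`. -/
lemma sum_inv_sq_progression_le {c η : ℝ} (hη : η ≠ 0) (F : Finset ℤ) :
    ∑ j ∈ F, ((1 + |c + η * j|) ^ 2)⁻¹ ≤ 1 + 8 / |η| := by
  set j₀ := round (-(c / η))
  have hη' : 0 < |η| := abs_pos.2 hη
  have h : ∀ j ∈ F, ((1 + |c + η * j|) ^ 2)⁻¹ ≤ tailKernel (2 / |η|) (j - j₀) := by
    intro j _
    refine le_trans ?_ (inv_sq_le_tailKernel (by positivity) _)
    refine inv_anti₀ (by positivity) (pow_le_pow_left₀ (by positivity) ?_ 2)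
    have h1 : c + η * j = η * (((j - j₀ : ℤ) : ℝ) - (-(c / η) - j₀)) := by
      push_cast; field_simp; ring
    have h2 : |(-(c / η) - j₀ : ℝ)| ≤ 1 / 2 := abs_sub_round _
    rw [h1, abs_mul, div_div_eq_mul_div, add_le_add_iff_left, mul_comm |η|, mul_div_right_comm]
    refine mul_le_mul_of_nonneg_right ?_ hη'.le
    by_cases hj : j - j₀ = 0
    · rw [hj]; simp
    · have h3 : (1 : ℝ) ≤ |((j - j₀ : ℤ) : ℝ)| := by
        rw [← Int.cast_abs]; exact_mod_cast Int.one_le_abs hj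
      have h4 := abs_sub_abs_le_abs_sub (((j - j₀ : ℤ) : ℝ)) (-(c / η) - j₀)
      linarith
  refine (Finset.sum_le_sum h).trans ?_
  have h2 := sum_tailKernel_le (z := 2 / |η|) (by positivity) (F.image fun j => j - j₀)
  rw [Finset.sum_image (by intro a _ b _ hab; simpa using hab)] at h2
  refine h2.trans (le_of_eq ?_)
  ring

/-- A compactly supported bump of class `C^{1,1}`. -/
def bump (x : ℝ) : ℝ := max 0 (1 - x ^ 2) ^ 2

lemma bump_nonneg (x : ℝ) : 0 ≤ bump x := sq_nonneg _

lemma bump_le_one (x : ℝ) : bump x ≤ 1 :=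
  pow_le_one₀ (le_max_left _ _) (max_le zero_le_one (by linarith [sq_nonneg x]))

lemma bump_eq_zero {x : ℝ} (hx : 1 ≤ |x|) : bump x = 0 := by
  have : (1 : ℝ) ≤ x ^ 2 := by rw [← sq_abs]; nlinarith
  rw [bump, max_eq_left (by linarith)]; norm_num

lemma le_bump {x : ℝ} (hx : |x| ≤ 1 / 2) : 9 / 16 ≤ bump x := by
  have h1 : x ^ 2 ≤ 1 / 4 := by rw [← sq_abs]; nlinarith [abs_nonneg x]
  have h2 : 3 / 4 ≤ max 0 (1 - x ^ 2) := le_max_of_le_right (by linarith)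
  rw [bump]; nlinarith

lemma abs_sq_max_taylor (A δ : ℝ) :
    |max 0 (A + δ) ^ 2 - max 0 A ^ 2 - 2 * max 0 A * δ| ≤ δ ^ 2 := by
  rw [abs_le]
  rcases le_total A 0 with h | h <;> rcases le_total (A + δ) 0 with h' | h' <;>
    simp only [max_eq_left h, max_eq_right h, max_eq_left h', max_eq_right h'] <;>
    constructor <;> nlinarith

lemma abs_bump_add_sub_le {x ε : ℝ} (hε : |ε| ≤ 1) : |bump (x + ε) - bump x| ≤ 35 * |ε| := by
  by_cases hx : |x| ≤ 2
  · have h := abs_sq_max_taylor (1 - x ^ 2) (-(2 * x * ε) - ε ^ 2)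
    have e : 1 - x ^ 2 + (-(2 * x * ε) - ε ^ 2) = 1 - (x + ε) ^ 2 := by ring
    rw [e] at h
    have hδ : |(-(2 * x * ε) - ε ^ 2)| ≤ 5 * |ε| := by
      have : -(2 * x * ε) - ε ^ 2 = -((2 * x + ε) * ε) := by ring
      rw [this, abs_neg, abs_mul]
      refine mul_le_mul_of_nonneg_right ?_ (abs_nonneg _)
      refine (abs_add_le _ _).trans ?_
      rw [abs_mul, abs_two]; linarith
    have hm : |max 0 (1 - x ^ 2)| ≤ 1 := by
      rw [abs_of_nonneg (le_max_left _ _)]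
      exact max_le zero_le_one (by linarith [sq_nonneg x])
    set δ := -(2 * x * ε) - ε ^ 2
    set a := max 0 (1 - x ^ 2)
    have h2 : |2 * a * δ| ≤ 10 * |ε| := by
      rw [abs_mul, abs_mul, abs_two]
      nlinarith [abs_nonneg ε, abs_nonneg δ, abs_nonneg a]
    have h3 : δ ^ 2 ≤ 25 * |ε| := by
      rw [← sq_abs]
      nlinarith [abs_nonneg ε, abs_nonneg δ]
    have h4 : bump (x + ε) - bump x =
      (max 0 (1 - (x + ε) ^ 2) ^ 2 - a ^ 2 - 2 * a * δ) + 2 * a * δ := by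
      simp only [bump]; ring
    rw [h4]
    exact (abs_add_le _ _).trans (by linarith)
  · have h1 := abs_sub_abs_le_abs_sub x (-ε)
    rw [abs_neg, sub_neg_eq_add] at h1
    rw [bump_eq_zero (by linarith : 1 ≤ |x|), bump_eq_zero (by linarith)]
    simp

lemma abs_bump_second_diff_le {x ε : ℝ} (hε : |ε| ≤ 1) :
    |bump (x + ε) + bump (x - ε) - 2 * bump x| ≤ 54 * ε ^ 2 := by
  by_cases hx : |x| ≤ 2
  · have key : ∀ ε : ℝ, |ε| ≤ 1 → |max 0 (1 - (x + ε) ^ 2) ^ 2 - max 0 (1 - x ^ 2) ^ 2 -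
        2 * max 0 (1 - x ^ 2) * (-(2 * x * ε) - ε ^ 2)| ≤ 25 * ε ^ 2 := by
      intro ε hε
      have h := abs_sq_max_taylor (1 - x ^ 2) (-(2 * x * ε) - ε ^ 2)
      have e : 1 - x ^ 2 + (-(2 * x * ε) - ε ^ 2) = 1 - (x + ε) ^ 2 := by ring
      rw [e] at h
      refine h.trans ?_
      have : (-(2 * x * ε) - ε ^ 2) ^ 2 = (2 * x + ε) ^ 2 * ε ^ 2 := by ring
      rw [this]
      refine mul_le_mul_of_nonneg_right ?_ (sq_nonneg _)
      rw [abs_le] at hx hε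
      nlinarith
    have h1 := key ε hε
    have h2 := key (-ε) (by rwa [abs_neg])
    have h3 : 0 ≤ max 0 (1 - x ^ 2) := le_max_left _ _
    have h4 : max 0 (1 - x ^ 2) ≤ 1 := max_le zero_le_one (by linarith [sq_nonneg x])
    simp only [bump, sub_eq_add_neg x ε] at *
    rw [abs_le] at *
    constructor <;> nlinarith [sq_nonneg ε]
  · have h1 := abs_sub_abs_le_abs_sub x (-ε)
    have h2 := abs_sub_abs_le_abs_sub x ε
    rw [abs_neg, sub_neg_eq_add] at h1
    rw [bump_eq_zero (by linarith : 1 ≤ |x|), bump_eq_zero (by linarith),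
      bump_eq_zero (by linarith)]
    simp; positivity

/-- The second difference of a product of two translated bumps. -/
lemma abs_bump_mul_second_diff_le {x y ε : ℝ} (hε : |ε| ≤ 1) :
    |bump (x + ε) * bump (y + ε) + bump (x - ε) * bump (y - ε) - 2 * (bump x * bump y)| ≤
      2600 * ε ^ 2 := by
  have e : bump (x + ε) * bump (y + ε) + bump (x - ε) * bump (y - ε) - 2 * (bump x * bump y) =
      (bump (x + ε) - bump x) * (bump (y + ε) - bump y) +
      (bump (x + -ε) - bump x) * (bump (y + -ε) - bump y) +
      bump x * (bump (y + ε) + bump (y - ε) - 2 * bump y) +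
      bump y * (bump (x + ε) + bump (x - ε) - 2 * bump x) := by
    simp only [← sub_eq_add_neg]; ring
  have hε' : |-ε| ≤ 1 := by rwa [abs_neg]
  have hp : ∀ u v : ℝ, |u| ≤ 35 * |ε| → |v| ≤ 35 * |ε| → |u * v| ≤ 1225 * ε ^ 2 := by
    intro u v hu hv
    rw [abs_mul, ← sq_abs ε]
    calc |u| * |v| ≤ (35 * |ε|) * (35 * |ε|) := mul_le_mul hu hv (abs_nonneg _) (by positivity)
      _ = _ := by ring
  have hq : ∀ a u : ℝ, 0 ≤ a → a ≤ 1 → |u| ≤ 54 * ε ^ 2 → |a * u| ≤ 54 * ε ^ 2 := by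
    intro a u ha ha1 hu
    rw [abs_mul, abs_of_nonneg ha]
    exact (mul_le_of_le_one_left (abs_nonneg _) ha1).trans hu
  have h1 := hp _ _ (abs_bump_add_sub_le (x := x) hε) (abs_bump_add_sub_le (x := y) hε)
  have h2 := hp _ _ ((abs_bump_add_sub_le (x := x) hε').trans_eq (by rw [abs_neg]))
    ((abs_bump_add_sub_le (x := y) hε').trans_eq (by rw [abs_neg]))
  have h3 := hq _ _ (bump_nonneg x) (bump_le_one x) (abs_bump_second_diff_le (x := y) hε)
  have h4 := hq _ _ (bump_nonneg y) (bump_le_one y) (abs_bump_second_diff_le (x := x) hε)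
  rw [e]
  refine (abs_add_le _ _).trans ?_
  have := abs_add_three ((bump (x + ε) - bump x) * (bump (y + ε) - bump y))
    ((bump (x + -ε) - bump x) * (bump (y + -ε) - bump y))
    (bump x * (bump (y + ε) + bump (y - ε) - 2 * bump y))
  nlinarith [sq_nonneg ε]

/-- The additive character `x ↦ e^{2πix}` of the reals. -/
def expi (x : ℝ) : ℂ := Complex.exp ((2 * Real.pi * x : ℝ) * Complex.I)

lemma expi_add (x y : ℝ) : expi (x + y) = expi x * expi y := by
  rw [expi, expi, expi, ← Complex.exp_add]; congr 1; push_cast; ring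

lemma norm_expi (x : ℝ) : ‖expi x‖ = 1 := Complex.norm_exp_ofReal_mul_I _

lemma expi_intCast (n : ℤ) : expi n = 1 := by
  rw [expi, Complex.exp_eq_one_iff]
  exact ⟨n, by push_cast; ring⟩

lemma expi_add_intCast (x : ℝ) (n : ℤ) : expi (x + n) = expi x := by
  rw [expi_add, expi_intCast, mul_one]

lemma conj_expi (x : ℝ) : (starRingEnd ℂ) (expi x) = expi (-x) := by
  rw [expi, expi, ← Complex.exp_conj, map_mul, Complex.conj_ofReal, Complex.conj_I]
  congr 1; push_cast; ring

lemma expi_add_expi_neg_sub_two (x : ℝ) :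
    expi x + expi (-x) - 2 = ((-(4 * Real.sin (Real.pi * x) ^ 2) : ℝ) : ℂ) := by
  have h1 : expi x + expi (-x) = ((2 * Real.cos (2 * (Real.pi * x)) : ℝ) : ℂ) := by
    rw [expi, expi, Complex.exp_mul_I, Complex.exp_mul_I]
    simp only [← Complex.ofReal_cos, ← Complex.ofReal_sin]
    rw [show 2 * Real.pi * -x = -(2 * (Real.pi * x)) by ring,
      show 2 * Real.pi * x = 2 * (Real.pi * x) by ring, Real.cos_neg, Real.sin_neg]
    push_cast; ring
  rw [h1, Real.cos_two_mul, Real.cos_sq']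
  push_cast; ring

lemma le_norm_expi_add_expi_neg_sub_two {x : ℝ} (hx : |x| ≤ 1 / 2) :
    16 * x ^ 2 ≤ ‖expi x + expi (-x) - 2‖ := by
  rw [expi_add_expi_neg_sub_two, Complex.norm_real, Real.norm_eq_abs, abs_neg,
    abs_of_nonneg (by positivity)]
  have h1 : 2 * |x| ≤ Real.sin (Real.pi * |x|) := by
    have := Real.mul_le_sin (x := Real.pi * |x|) (by positivity)
      (by nlinarith [Real.pi_pos])
    have h2 : 2 / Real.pi * (Real.pi * |x|) = 2 * |x| := by
      field_simp
    linarith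
  have h2 : Real.sin (Real.pi * |x|) ^ 2 = Real.sin (Real.pi * x) ^ 2 := by
    rcases abs_cases x with ⟨h, _⟩ | ⟨h, _⟩ <;> rw [h]
    rw [mul_neg, Real.sin_neg, neg_sq]
  rw [← h2, ← sq_abs]
  nlinarith [abs_nonneg x]

/-- The Fourier transform of the autocorrelation of the bump of width `L`. -/
def corrSum (L : ℕ) (h : ℤ) (β : ℝ) : ℂ :=
  ∑' n : ℤ, ((bump (n / L) * bump ((n + h) / L) : ℝ) : ℂ) * expi (n * β)

lemma corr_eq_zero {L : ℕ} (hL : 0 < L) (h n : ℤ) (hn : n ∉ Finset.Icc (-(L : ℤ)) L) :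
    bump (n / L) * bump ((n + h) / L) = 0 := by
  rw [bump_eq_zero, zero_mul]
  have hL' : (0 : ℝ) < L := by exact_mod_cast hL
  rw [abs_div, abs_of_pos hL', le_div_iff₀ hL', one_mul, ← Int.cast_abs]
  rw [Finset.mem_Icc, ← abs_le, not_le] at hn
  exact_mod_cast hn.le

lemma norm_corrSum_le {L : ℕ} (hL : 0 < L) (h : ℤ) (β : ℝ) : ‖corrSum L h β‖ ≤ 3 * L := by
  have hL' : (1 : ℝ) ≤ L := by exact_mod_cast hL
  rw [corrSum, tsum_eq_sum (s := Finset.Icc (-(L : ℤ)) L)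
    (fun n hn => by rw [corr_eq_zero hL h n hn]; simp)]
  refine (norm_sum_le_of_le (n := fun _ : ℤ => (1 : ℝ)) _ fun n _ => ?_).trans ?_
  · rw [norm_mul, norm_expi, mul_one, Complex.norm_real, Real.norm_eq_abs,
      abs_of_nonneg (mul_nonneg (bump_nonneg _) (bump_nonneg _))]
    exact mul_le_one₀ (bump_le_one _) (bump_nonneg _) (bump_le_one _)
  · have : (Finset.Icc (-(L : ℤ)) L).card = 2 * L + 1 := by simp; omega
    rw [Finset.sum_const, this]; simp; linarith

lemma norm_mul_corrSum_le {L : ℕ} (hL : 0 < L) (h : ℤ) (β : ℝ) :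
    ‖expi β + expi (-β) - 2‖ * ‖corrSum L h β‖ ≤ 13000 / L := by
  have hL' : (1 : ℝ) ≤ L := by exact_mod_cast hL
  set G : ℤ → ℝ := fun n => bump (n / L) * bump ((n + h) / L) with hG
  have hG0 : ∀ n, n ∉ Finset.Icc (-(L : ℤ)) L → G n = 0 := fun n hn => corr_eq_zero hL h n hn
  set B := Finset.Icc (-(L : ℤ) - 1) (L + 1) with hB
  have hsum : ∀ s : ℤ, |s| ≤ 1 → expi (s * β) * corrSum L h β =
      ∑ n ∈ B, (G (n - s) : ℂ) * expi (n * β) := by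
    intro s hs
    rw [abs_le] at hs
    rw [← tsum_eq_sum (L := .unconditional ℤ), ← (Equiv.addRight s).tsum_eq, corrSum,
      ← tsum_mul_left]
    · refine tsum_congr fun n => ?_
      simp only [Equiv.coe_addRight, add_sub_cancel_right]
      rw [Int.cast_add, add_mul, expi_add]
      ring
    · intro n hn
      rw [hG0, Complex.ofReal_zero, zero_mul]
      rw [hB, Finset.mem_Icc] at hn
      rw [Finset.mem_Icc]
      omega
  have e : (expi β + expi (-β) - 2) * corrSum L h β =
      ∑ n ∈ B, ((G (n + 1) + G (n - 1) - 2 * G n : ℝ) : ℂ) * expi (n * β) := by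
    have h1 := hsum 1 (by simp)
    have h2 := hsum (-1) (by simp)
    have h3 := hsum 0 (by simp)
    simp only [Int.cast_one, one_mul, Int.cast_neg, neg_mul, sub_neg_eq_add, Int.cast_zero,
      zero_mul, sub_zero] at h1 h2 h3
    have h0 : expi 0 = 1 := by simpa using expi_intCast 0
    rw [h0, one_mul] at h3
    rw [sub_mul, add_mul, h1, h2, h3, Finset.mul_sum, ← Finset.sum_add_distrib,
      ← Finset.sum_sub_distrib]
    refine Finset.sum_congr rfl fun n _ => ?_
    push_cast; ring
  rw [← norm_mul, e]
  refine (norm_sum_le_of_le (n := fun _ : ℤ => 2600 * (1 / (L : ℝ)) ^ 2) _ fun n _ => ?_).trans ?_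
  · rw [norm_mul, norm_expi, mul_one, Complex.norm_real, Real.norm_eq_abs]
    have := abs_bump_mul_second_diff_le (x := n / L) (y := (n + h) / L) (ε := 1 / L)
      (by rw [abs_of_pos (by positivity), div_le_one (by positivity)]; exact hL')
    simp only [hG]
    push_cast
    convert this using 4 <;> ring_nf
  · have : B.card = 2 * L + 3 := by simp [hB]; omega
    rw [Finset.sum_const, this, nsmul_eq_mul]
    push_cast
    rw [one_div, inv_pow, ← div_eq_mul_inv, mul_div_assoc', div_le_div_iff₀ (by positivity) (by positivity)]
    nlinarith

lemma corrSum_add_intCast (L : ℕ) (h : ℤ) (β : ℝ) (i : ℤ) :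
    corrSum L h (β + i) = corrSum L h β := by
  refine tsum_congr fun n => ?_
  rw [mul_add, ← Int.cast_mul, expi_add_intCast]

lemma norm_corrSum_mul_le {L : ℕ} (hL : 0 < L) (h : ℤ) (β : ℝ) :
    ‖corrSum L h β‖ ≤ 1700 * L * ((1 + L * |β - round β|) ^ 2)⁻¹ := by
  have hL' : (1 : ℝ) ≤ L := by exact_mod_cast hL
  have h1 := norm_mul_corrSum_le hL h (β - round β)
  have h2 := le_norm_expi_add_expi_neg_sub_two (abs_sub_round β)
  have h3 : corrSum L h (β - round β) = corrSum L h β := by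
    have := corrSum_add_intCast L h (β - round β) (round β)
    rw [← this, sub_add_cancel]
  rw [h3] at h1
  have h4 := norm_corrSum_le hL h β
  set x := β - round β
  set F := ‖corrSum L h β‖
  have hF : 0 ≤ F := norm_nonneg _
  rw [← div_eq_mul_inv, le_div_iff₀ (by positivity)]
  have h5 : 16 * x ^ 2 * F ≤ 13000 / L := (mul_le_mul_of_nonneg_right h2 hF).trans h1
  rw [le_div_iff₀ (by positivity)] at h5
  have h6 : (1 + L * |x|) ^ 2 ≤ 2 + 2 * (L ^ 2 * x ^ 2) := by
    rw [← sq_abs x]; nlinarith [sq_nonneg (1 - L * |x|)]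
  calc F * (1 + L * |x|) ^ 2 ≤ F * (2 + 2 * (L ^ 2 * x ^ 2)) :=
        mul_le_mul_of_nonneg_left h6 hF
    _ = 2 * F + L / 8 * (16 * x ^ 2 * F * L) := by ring
    _ ≤ 2 * (3 * L) + L / 8 * 13000 := by gcongr
    _ ≤ 1700 * L := by linarith

/-- The smoothed quadratic Weyl sum of length `L`. -/
def weylSum (L : ℕ) (τ : ℝ) : ℂ :=
  ∑ n ∈ Finset.Icc (-(L : ℤ)) L, ((bump (n / L) : ℝ) : ℂ) * expi (τ * n ^ 2)

lemma bump_div_eq_zero {L : ℕ} (hL : 0 < L) (n : ℤ) (hn : n ∉ Finset.Icc (-(L : ℤ)) L) :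
    bump (n / L) = 0 := by
  have hL' : (0 : ℝ) < L := by exact_mod_cast hL
  rw [bump_eq_zero]
  rw [abs_div, abs_of_pos hL', le_div_iff₀ hL', one_mul, ← Int.cast_abs]
  rw [Finset.mem_Icc, ← abs_le, not_le] at hn
  exact_mod_cast hn.le

lemma norm_weylSum_sq_le {L : ℕ} (hL : 0 < L) (τ : ℝ) :
    ‖weylSum L τ‖ ^ 2 ≤
      ∑ h ∈ Finset.Icc (-(2 * L : ℤ)) (2 * L), ‖corrSum L h (2 * τ * h)‖ := by
  set f : ℤ → ℂ := fun n => ((bump (n / L) : ℝ) : ℂ) * expi (τ * n ^ 2) with hf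
  set B := Finset.Icc (-(L : ℤ)) L
  set H := Finset.Icc (-(2 * L : ℤ)) (2 * L)
  have hf0 : ∀ n, n ∉ B → f n = 0 := fun n hn => by
    rw [hf]; simp only [bump_div_eq_zero hL n hn, Complex.ofReal_zero, zero_mul]
  have hshift : ∀ n ∈ B, ∑ m ∈ B, f m = ∑ h ∈ H, f (n + h) := by
    intro n hn
    rw [← tsum_eq_sum (L := .unconditional ℤ) hf0, ← (Equiv.addLeft n).tsum_eq,
      ← tsum_eq_sum (L := .unconditional ℤ) (f := fun h => f (n + h))]
    · rfl
    · intro h hh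
      apply hf0
      rw [Finset.mem_Icc] at hn hh ⊢
      omega
  have hprod : ∀ n h, (starRingEnd ℂ) (f n) * f (n + h) = expi (τ * h ^ 2) *
      (((bump (n / L) * bump ((n + h) / L) : ℝ) : ℂ) * expi (n * (2 * τ * h))) := by
    intro n h
    simp only [hf, map_mul, Complex.conj_ofReal, conj_expi]
    have e : τ * ((n + h : ℤ) : ℝ) ^ 2 = τ * n ^ 2 + (τ * h ^ 2 + n * (2 * τ * h)) := by
      push_cast; ring
    rw [e, expi_add, expi_add]
    have h1 : expi (-(τ * n ^ 2)) * expi (τ * n ^ 2) = 1 := by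
      rw [← expi_add, neg_add_cancel]; simpa using expi_intCast 0
    push_cast
    linear_combination (bump (n / L) : ℂ) * (bump ((n + h) / L) : ℂ) * expi (τ * h ^ 2) *
      expi (n * (2 * τ * h)) * h1
  have key : (starRingEnd ℂ) (weylSum L τ) * weylSum L τ =
      ∑ h ∈ H, expi (τ * h ^ 2) * corrSum L h (2 * τ * h) := by
    calc (starRingEnd ℂ) (weylSum L τ) * weylSum L τ =
        ∑ n ∈ B, (starRingEnd ℂ) (f n) * ∑ m ∈ B, f m := by
          rw [weylSum, map_sum, Finset.sum_mul]
      _ = ∑ n ∈ B, ∑ h ∈ H, (starRingEnd ℂ) (f n) * f (n + h) := by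
          refine Finset.sum_congr rfl fun n hn => ?_
          rw [hshift n hn, Finset.mul_sum]
      _ = ∑ h ∈ H, ∑ n ∈ B, (starRingEnd ℂ) (f n) * f (n + h) := Finset.sum_comm
      _ = _ := by
          refine Finset.sum_congr rfl fun h _ => ?_
          simp only [hprod]
          rw [← Finset.mul_sum, corrSum, tsum_eq_sum (s := B)
            (fun n hn => by rw [corr_eq_zero hL h n hn]; simp)]
  have h1 : ‖weylSum L τ‖ ^ 2 = ‖(starRingEnd ℂ) (weylSum L τ) * weylSum L τ‖ := by
    rw [norm_mul, RCLike.norm_conj, sq]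
  rw [h1, key]
  refine norm_sum_le_of_le _ fun h _ => ?_
  rw [norm_mul, norm_expi, one_mul]

/-- Integers `h` with `|h| ≤ R` in which `a h - q i(h)` takes a fixed value. -/
lemma fiber_eq_image {a q : ℤ} (hq : 0 < q) (haq : IsCoprime a q) {R : ℕ} (hqR : q ≤ R)
    (i : ℤ → ℤ) (s : ℤ) (A : Finset ℤ)
    (hA : ∀ h ∈ A, |h| ≤ R ∧ a * h - q * i h = s) :
    A = ∅ ∨ ∃ r : ℤ, ∃ J : Finset ℤ, (J.card : ℝ) ≤ 5 * R / q ∧ A = J.image fun j => r + q * j := by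
  rcases A.eq_empty_or_nonempty with h | ⟨r, hr⟩
  · exact Or.inl h
  right
  have hdvd : ∀ h ∈ A, q ∣ h - r := by
    intro h hh
    have h1 : q ∣ a * (h - r) := ⟨i h - i r, by linarith [(hA h hh).2, (hA r hr).2]⟩
    exact haq.symm.dvd_of_dvd_mul_left h1
  refine ⟨r, A.image fun h => (h - r) / q, ?_, ?_⟩
  · have hsub : (A.image fun h => (h - r) / q) ⊆ Finset.Icc (-(2 * R / q)) (2 * R / q) := by
      intro j hj
      obtain ⟨h, hh, rfl⟩ := Finset.mem_image.1 hj
      obtain ⟨k, hk⟩ := hdvd h hh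
      have h1 := (hA h hh).1
      have h2 := (hA r hr).1
      rw [hk, Int.mul_ediv_cancel_left _ hq.ne', Finset.mem_Icc]
      rw [abs_le] at h1 h2
      have h3 : k ≤ 2 * R / q := (Int.le_ediv_iff_mul_le hq).2 (by linarith)
      have h4 : -k ≤ 2 * R / q := (Int.le_ediv_iff_mul_le hq).2 (by linarith)
      exact ⟨by linarith, h3⟩
    have h1 := Finset.card_le_card hsub
    rw [Int.card_Icc] at h1
    have h2 : 0 ≤ 2 * (R : ℤ) / q := Int.ediv_nonneg (by positivity) hq.le
    have h3 : 2 * (R : ℤ) / q * q ≤ 2 * R := Int.ediv_mul_le _ hq.ne'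
    set J := 2 * (R : ℤ) / q
    have h4 : ((A.image fun h => (h - r) / q).card : ℤ) ≤ 2 * J + 1 := by omega
    have hq' : (0 : ℝ) < q := by exact_mod_cast hq
    rw [le_div_iff₀ hq']
    have h5 : ((A.image fun h => (h - r) / q).card : ℤ) * q ≤ 5 * R := by nlinarith
    exact_mod_cast h5
  · rw [Finset.image_image]
    ext h
    simp only [Finset.mem_image, Function.comp]
    constructor
    · intro hh
      exact ⟨h, hh, by rw [Int.mul_ediv_cancel' (hdvd h hh)]; ring⟩
    · rintro ⟨h', hh', rfl⟩
      rw [Int.mul_ediv_cancel' (hdvd h' hh')]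
      simpa using hh'

lemma sum_tailKernel_le_of_notMem {z : ℝ} (hz : 0 < z) {F : Finset ℤ} (hF : 0 ∉ F) :
    ∑ k ∈ F, tailKernel z k ≤ 4 * z := by
  have h := sum_tailKernel_le hz (insert 0 F)
  rw [Finset.sum_insert hF] at h
  have : tailKernel z 0 = 1 := by simp [tailKernel, hz.ne']
  linarith

lemma sum_fiber_le {a q : ℤ} (hq : 0 < q) (haq : IsCoprime a q) {N : ℕ} (hqN : q ≤ N)
    (i : ℤ → ℤ) (s : ℤ) (β : ℝ) (hβ : |β| * N ≤ 1) (A : Finset ℤ)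
    (hA : ∀ h ∈ A, |h| ≤ 4 * N ∧ a * h - q * i h = s) :
    ∑ h ∈ A, ((1 + |2 * N * (s + β * h) / q|) ^ 2)⁻¹ ≤ 40 * N / (q + N ^ 2 * |β|) := by
  have hq' : (0 : ℝ) < q := by exact_mod_cast hq
  have hq1 : (1 : ℝ) ≤ q := by exact_mod_cast hq
  have hqN' : (q : ℝ) ≤ N := by exact_mod_cast hqN
  have hN : (0 : ℝ) < N := by linarith
  have hden : 0 < q + N ^ 2 * |β| := by positivity
  rcases fiber_eq_image hq haq (R := 4 * N) (by push_cast; linarith) i s A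
    (by push_cast; exact hA) with h | ⟨r, J, hJ, h⟩
  · rw [h, Finset.sum_empty]; positivity
  have hAcard : (A.card : ℝ) ≤ 20 * N / q := by
    have h1 : (A.card : ℝ) ≤ J.card := by rw [h]; exact_mod_cast Finset.card_image_le
    refine h1.trans (hJ.trans (le_of_eq ?_))
    push_cast; ring
  by_cases hc : N ^ 2 * |β| ≤ q
  · have h1 : ∑ h ∈ A, ((1 + |2 * N * (s + β * h) / q|) ^ 2)⁻¹ ≤ (A.card : ℝ) := by
      refine (Finset.sum_le_card_nsmul A _ (1 : ℝ) fun h _ => inv_le_one_of_one_le₀ ?_).trans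
        (by rw [nsmul_eq_mul, mul_one])
      exact one_le_pow₀ (by linarith [abs_nonneg (2 * N * (s + β * h) / q)])
    refine h1.trans (hAcard.trans ?_)
    rw [div_le_div_iff₀ hq' hden]
    nlinarith
  · have hβ0 : β ≠ 0 := by
      rintro rfl
      simp at hc; linarith
    have hβ' : 0 < |β| := abs_pos.2 hβ0
    have h1 := sum_inv_sq_progression_le (c := 2 * N * (s + β * r) / q) (η := 2 * N * β)
      (by positivity) J
    have h2 : ∑ h ∈ A, ((1 + |2 * N * (s + β * h) / q|) ^ 2)⁻¹ =
        ∑ j ∈ J, ((1 + |2 * N * (s + β * r) / q + 2 * N * β * j|) ^ 2)⁻¹ := by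
      rw [h, Finset.sum_image (by
        intro x _ y _ hxy
        exact mul_left_cancel₀ hq.ne' (add_left_cancel hxy))]
      refine Finset.sum_congr rfl fun j _ => ?_
      congr 4
      push_cast; field_simp; ring
    rw [h2]
    refine h1.trans ?_
    rw [abs_mul, abs_of_pos (by positivity : (0 : ℝ) < 2 * N), ← sub_nonneg]
    have e : 1 + 8 / (2 * N * |β|) = (N * |β| + 4) / (N * |β|) := by field_simp; ring
    rw [e, sub_nonneg, div_le_div_iff₀ (by positivity) hden]
    push Not at hc
    have h3 : (N * |β| + 4) * (q + N ^ 2 * |β|) ≤ 5 * (2 * (N ^ 2 * |β|)) :=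
      mul_le_mul (by linarith) (by linarith) hden.le (by norm_num)
    nlinarith

lemma sum_far_fiber_le {a q : ℤ} (hq : 0 < q) (haq : IsCoprime a q) {N : ℕ} (hqN : q ≤ N)
    (i : ℤ → ℤ) {s : ℤ} (hs : 10 ≤ |s|) (β : ℝ) (hβ : |β| * N ≤ 1) (A : Finset ℤ)
    (hA : ∀ h ∈ A, |h| ≤ 4 * N ∧ a * h - q * i h = s) :
    ∑ h ∈ A, ((1 + |2 * N * (s + β * h) / q|) ^ 2)⁻¹ ≤ 20 * N / q * tailKernel (q / N) s := by
  have hq' : (0 : ℝ) < q := by exact_mod_cast hq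
  have hqN' : (q : ℝ) ≤ N := by exact_mod_cast hqN
  have hN : (0 : ℝ) < N := by linarith
  have hK := tailKernel_nonneg (q / N) s
  rcases fiber_eq_image hq haq (R := 4 * N) (by push_cast; linarith) i s A
    (by push_cast; exact hA) with h | ⟨r, J, hJ, h⟩
  · rw [h, Finset.sum_empty]; positivity
  have hAcard : (A.card : ℝ) ≤ 20 * N / q := by
    have h1 : (A.card : ℝ) ≤ J.card := by rw [h]; exact_mod_cast Finset.card_image_le
    refine h1.trans (hJ.trans (le_of_eq ?_))
    push_cast; ring
  have h1 : ∑ h ∈ A, ((1 + |2 * N * (s + β * h) / q|) ^ 2)⁻¹ ≤ A.card • tailKernel (q / N) s := by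
    refine Finset.sum_le_card_nsmul _ _ _ fun h hh => ?_
    refine le_trans ?_ (inv_sq_le_tailKernel (by positivity) _)
    refine inv_anti₀ (by positivity) (pow_le_pow_left₀ (by positivity) ?_ 2)
    have h2 : |β * h| ≤ 4 := by
      rw [abs_mul]
      have : |(h : ℝ)| ≤ 4 * N := by rw [← Int.cast_abs]; exact_mod_cast (hA h hh).1
      nlinarith [abs_nonneg β]
    have h3 : (10 : ℝ) ≤ |(s : ℝ)| := by rw [← Int.cast_abs]; exact_mod_cast hs
    have h4 := abs_sub_abs_le_abs_sub (s : ℝ) (-(β * h))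
    rw [abs_neg, sub_neg_eq_add] at h4
    rw [abs_div, abs_mul, abs_of_pos hq', abs_of_pos (by positivity : (0 : ℝ) < 2 * N),
      div_div_eq_mul_div, add_le_add_iff_left, div_le_div_iff_of_pos_right hq']
    nlinarith
  rw [nsmul_eq_mul] at h1
  exact h1.trans (mul_le_mul_of_nonneg_right hAcard hK)

/-- Weyl's inequality for the smoothed quadratic Weyl sum. -/
theorem weyl_bound {N : ℕ} (hN : 0 < N) (τ : ℝ) : ∃ a q : ℤ, 0 < q ∧ q ≤ N ∧
    ‖weylSum (2 * N) τ‖ ^ 2 * (q + N ^ 2 * |q * (2 * τ) - a|) ≤ 4000000 * N ^ 2 := by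
  obtain ⟨ρ, h1, h2⟩ := Real.exists_rat_abs_sub_le_and_den_le (2 * τ) hN
  have hcop : IsCoprime ρ.num (ρ.den : ℤ) := by
    rw [Int.isCoprime_iff_gcd_eq_one]; exact ρ.reduced
  set a : ℤ := ρ.num
  set q : ℤ := (ρ.den : ℤ) with hqdef
  have hq : 0 < q := by rw [hqdef]; exact_mod_cast ρ.pos
  have hqN : q ≤ N := by rw [hqdef]; exact_mod_cast h2
  have hq' : (0 : ℝ) < q := by exact_mod_cast hq
  have hqN' : (q : ℝ) ≤ N := by exact_mod_cast hqN
  have hN' : (0 : ℝ) < N := by exact_mod_cast hN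
  set β : ℝ := q * (2 * τ) - a with hβdef
  have hβ : |β| * N ≤ 1 := by
    have e : β = q * (2 * τ - ρ) := by
      have hρ : (ρ : ℝ) = a / q := by
        rw [Rat.cast_def ρ, hqdef, Int.cast_natCast]
      rw [hρ, hβdef]; field_simp
    have hqd : (ρ.den : ℝ) = q := by rw [hqdef]; simp
    rw [hqd, le_div_iff₀ (by positivity)] at h1
    rw [e, abs_mul, abs_of_pos hq']
    nlinarith [abs_nonneg (2 * τ - ρ)]
  refine ⟨a, q, hq, hqN, ?_⟩
  set i : ℤ → ℤ := fun h => round (2 * τ * h)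
  set sf : ℤ → ℤ := fun h => a * h - q * i h
  set H := Finset.Icc (-(4 * N : ℤ)) (4 * N)
  set D := q + N ^ 2 * |β| with hD
  have hDpos : 0 < D := by positivity
  have hD2 : D ≤ 2 * N := by rw [hD]; nlinarith
  set ψ : ℤ → ℤ → ℝ := fun s h => ((1 + |2 * N * (s + β * h) / q|) ^ 2)⁻¹
  have hcorr : ∀ h : ℤ, ‖corrSum (2 * N) h (2 * τ * h)‖ ≤ 3400 * N * ψ (sf h) h := by
    intro h
    refine (norm_corrSum_mul_le (by omega) h _).trans (le_of_eq ?_)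
    have e : ((2 * N : ℕ) : ℝ) * |2 * τ * h - round (2 * τ * h)| =
        |2 * N * (sf h + β * h) / q| := by
      have : 2 * N * (sf h + β * h) / q = 2 * N * (2 * τ * h - round (2 * τ * h)) := by
        simp only [sf, i, hβdef]
        push_cast; field_simp; ring
      rw [this, abs_mul, abs_of_pos (by positivity : (0 : ℝ) < 2 * N)]
      push_cast; ring
    rw [e]; push_cast; ring
  have hfib : ∀ s h, h ∈ H.filter (fun h => sf h = s) → |h| ≤ 4 * N ∧ a * h - q * i h = s := by
    intro s h hh
    rw [Finset.mem_filter, Finset.mem_Icc, ← abs_le] at hh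
    exact hh
  set E : ℤ → ℝ := fun s => ∑ h ∈ H.filter (fun h => sf h = s), ψ s h
  have hE0 : ∀ s, 0 ≤ E s := fun s => Finset.sum_nonneg fun h _ => by positivity
  have hE1 : ∀ s, E s ≤ 40 * N / D := fun s => sum_fiber_le hq hcop hqN i s β hβ _ (hfib s)
  have hE2 : ∀ s, 10 ≤ |s| → E s ≤ 20 * N / q * tailKernel (q / N) s :=
    fun s hs => sum_far_fiber_le hq hcop hqN i hs β hβ _ (hfib s)
  have hsum : ∑ h ∈ H, ψ (sf h) h = ∑ s ∈ H.image sf, E s := by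
    rw [← Finset.sum_fiberwise_of_maps_to (g := sf) (t := H.image sf)
      (fun h hh => Finset.mem_image_of_mem _ hh)]
    refine Finset.sum_congr rfl fun s _ => Finset.sum_congr rfl fun h hh => ?_
    rw [(Finset.mem_filter.1 hh).2]
  have hnear : ∑ s ∈ (H.image sf).filter (fun s => ¬ 10 ≤ |s|), E s ≤ 760 * N / D := by
    have hsub : (H.image sf).filter (fun s => ¬ 10 ≤ |s|) ⊆ Finset.Icc (-9) 9 := by
      intro s hs
      have := (Finset.mem_filter.1 hs).2
      rw [Finset.mem_Icc, ← abs_le]; omega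
    refine (Finset.sum_le_sum_of_subset_of_nonneg hsub fun s _ _ => hE0 s).trans ?_
    refine (Finset.sum_le_card_nsmul _ _ _ fun s _ => hE1 s).trans (le_of_eq ?_)
    rw [nsmul_eq_mul]; simp; ring
  have hfar : ∑ s ∈ (H.image sf).filter (fun s => 10 ≤ |s|), E s ≤ 160 * N / D := by
    refine (Finset.sum_le_sum fun s hs => hE2 s (Finset.mem_filter.1 hs).2).trans ?_
    rw [← Finset.mul_sum]
    have h3 := sum_tailKernel_le_of_notMem (z := q / N) (by positivity)
      (F := (H.image sf).filter (fun s => 10 ≤ |s|)) (by simp)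
    refine (mul_le_mul_of_nonneg_left h3 (by positivity)).trans ?_
    have e : 20 * N / q * (4 * (q / N)) = (80 : ℝ) := by field_simp; norm_num
    rw [e, le_div_iff₀ hDpos]
    linarith
  have htot : ∑ h ∈ H, ψ (sf h) h ≤ 920 * N / D := by
    rw [hsum, ← Finset.sum_filter_add_sum_filter_not _ (fun s => 10 ≤ |s|)]
    refine (add_le_add hfar hnear).trans (le_of_eq ?_)
    ring
  have hmain : ‖weylSum (2 * N) τ‖ ^ 2 ≤ 3400 * N * (920 * N / D) := by
    refine (norm_weylSum_sq_le (by omega) τ).trans ?_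
    have eH : Finset.Icc (-(2 * (2 * N : ℕ) : ℤ)) (2 * (2 * N : ℕ)) = H := by
      simp only [H]; congr 1 <;> push_cast <;> ring
    rw [eH]
    refine (Finset.sum_le_sum fun h _ => hcorr h).trans ?_
    rw [← Finset.mul_sum]
    exact mul_le_mul_of_nonneg_left htot (by positivity)
  have e : 3400 * N * (920 * N / D) = 3128000 * (N : ℝ) ^ 2 / D := by ring
  rw [e, le_div_iff₀ hDpos] at hmain
  nlinarith [sq_nonneg (N : ℝ)]

lemma expi_nsmul (n : ℕ) (x : ℝ) : expi (n * x) = expi x ^ n := by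
  rw [expi, expi, ← Complex.exp_nat_mul]; congr 1; push_cast; ring

lemma expi_sum {ι : Type*} (s : Finset ι) (f : ι → ℝ) :
    expi (∑ i ∈ s, f i) = ∏ i ∈ s, expi (f i) := by
  classical
  induction s using Finset.induction_on with
  | empty => simpa using expi_intCast 0
  | insert a s ha ih => rw [Finset.sum_insert ha, Finset.prod_insert ha, expi_add, ih]

lemma sum_expi_div {M : ℕ} (hM : 0 < M) (k : ℤ) :
    ∑ t ∈ Finset.range M, expi (t * (k / M)) = if (M : ℤ) ∣ k then (M : ℂ) else 0 := by
  have hM' : (M : ℝ) ≠ 0 := by exact_mod_cast hM.ne'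
  simp only [expi_nsmul]
  split_ifs with h
  · obtain ⟨j, rfl⟩ := h
    have : expi (((M * j : ℤ) : ℝ) / M) = 1 := by
      rw [← expi_intCast j]; congr 1; push_cast; field_simp
    simp only [this, one_pow, Finset.sum_const, Finset.card_range, nsmul_eq_mul, mul_one]
  · have hne : expi ((k : ℝ) / M) ≠ 1 := by
      intro h1
      rw [expi, Complex.exp_eq_one_iff] at h1
      obtain ⟨n, hn⟩ := h1
      apply h
      have h2 : ((2 * Real.pi * (k / M) : ℝ) : ℂ) = ((2 * Real.pi * n : ℝ) : ℂ) := by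
        apply mul_right_cancel₀ Complex.I_ne_zero
        rw [hn]; push_cast; ring
      have h3 := mul_left_cancel₀ (by positivity) (Complex.ofReal_injective h2)
      rw [div_eq_iff hM'] at h3
      exact ⟨n, by rw [mul_comm]; exact_mod_cast h3⟩
    rw [geom_sum_eq hne, ← expi_nsmul, mul_div_cancel₀ _ hM', expi_intCast, sub_self, zero_div]

lemma sum_norm_sq_expi {M : ℕ} (hM : 0 < M) {T : Finset ℕ} (hT : T ⊆ Finset.range M)
    (a : ℕ → ℂ) :
    ∑ m ∈ Finset.range M, ‖∑ t ∈ T, a t * expi (m * (-t / M))‖ ^ 2 = M * ∑ t ∈ T, ‖a t‖ ^ 2 := by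
  apply Complex.ofReal_injective
  push_cast
  have h1 : ∀ z : ℂ, (‖z‖ : ℂ) ^ 2 = (starRingEnd ℂ) z * z := fun z => by
    rw [Complex.conj_mul']
  have h2 : ∀ m : ℕ, (‖∑ t ∈ T, a t * expi (m * (-t / M))‖ : ℂ) ^ 2 =
      ∑ s ∈ T, ∑ t ∈ T, (starRingEnd ℂ) (a s) * a t * expi (m * (((s - t : ℤ) : ℝ) / M)) := by
    intro m
    rw [h1, map_sum, Finset.sum_mul_sum]
    refine Finset.sum_congr rfl fun s _ => Finset.sum_congr rfl fun t _ => ?_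
    rw [map_mul, conj_expi]
    have : (m * (((s - t : ℤ) : ℝ) / M) : ℝ) = -(m * (-s / M)) + m * (-t / M) := by
      push_cast; ring
    rw [this, expi_add]; ring
  simp only [h2]
  rw [Finset.sum_comm, Finset.mul_sum]
  refine Finset.sum_congr rfl fun s hs => ?_
  rw [Finset.sum_comm]
  simp only [← Finset.mul_sum, sum_expi_div hM]
  rw [Finset.sum_eq_single_of_mem s hs]
  · rw [sub_self, if_pos (dvd_zero _), h1]; ring
  · intro t ht hts
    rw [if_neg, mul_zero]
    intro hdvd
    have h3 := Finset.mem_range.1 (hT hs)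
    have h4 := Finset.mem_range.1 (hT ht)
    have h5 := Int.eq_zero_of_abs_lt_dvd hdvd (by rw [abs_lt]; omega)
    omega

lemma rep_le_norm_sum_weylSum {N : ℕ} (hN : 0 < N) {M : ℕ} (hM : 0 < M) (k : ℕ) {m : ℕ}
    (hm : m ≤ N ^ 2) :
    M * ((9 / 16 : ℝ) ^ k * rep k m) ≤
      ‖∑ t ∈ Finset.range M, weylSum (2 * N) (t / M) ^ k * expi (m * (-t / M))‖ := by
  classical
  set B := Finset.Icc (-((2 * N : ℕ) : ℤ)) (2 * N : ℕ)
  set w : ℤ → ℝ := fun n => bump (n / (2 * N : ℕ)) with hw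
  set P := Fintype.piFinset fun _ : Fin k => B
  have hw0 : ∀ v : Fin k → ℤ, 0 ≤ ∏ i, w (v i) := fun v =>
    Finset.prod_nonneg fun i _ => bump_nonneg _
  have hterm : ∀ t : ℕ, weylSum (2 * N) (t / M) ^ k * expi (m * (-t / M)) =
      ∑ v ∈ P, ((∏ i, w (v i) : ℝ) : ℂ) * expi (t * (((∑ i, v i ^ 2 - m : ℤ) : ℝ) / M)) := by
    intro t
    have hpow : weylSum (2 * N) (t / M) ^ k =
        ∏ _i : Fin k, ∑ n ∈ B, ((w n : ℝ) : ℂ) * expi (t / M * n ^ 2) := by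
      rw [Finset.prod_const, Finset.card_univ, Fintype.card_fin, weylSum]
    rw [hpow, Finset.prod_univ_sum, Finset.sum_mul]
    refine Finset.sum_congr rfl fun v _ => ?_
    rw [Finset.prod_mul_distrib, ← expi_sum, mul_assoc, ← expi_add, Complex.ofReal_prod]
    congr 2
    push_cast
    rw [← Finset.mul_sum]
    ring
  have hsum : ∑ t ∈ Finset.range M, weylSum (2 * N) (t / M) ^ k * expi (m * (-t / M)) =
      ((∑ v ∈ P, (∏ i, w (v i)) * (if (M : ℤ) ∣ ∑ i, v i ^ 2 - m then (M : ℝ) else 0) : ℝ) : ℂ) := by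
    simp only [hterm]
    rw [Finset.sum_comm, Complex.ofReal_sum]
    refine Finset.sum_congr rfl fun v _ => ?_
    rw [← Finset.mul_sum, sum_expi_div hM, Complex.ofReal_mul]
    congr 1
    split_ifs <;> simp
  rw [hsum, Complex.norm_real]
  refine le_trans ?_ (le_abs_self _)
  set R := (finite_sum_sq_eq (ι := Fin k) (m : ℤ)).toFinset with hR
  have hcard : rep k m = R.card := by
    rw [rep, hR, ← Nat.card_eq_card_finite_toFinset]; rfl
  have hb : ∀ v ∈ R, ∀ i, |v i| ≤ N := by
    intro v hv i
    have h1 : ∑ i, v i ^ 2 = (m : ℤ) := by simpa [hR] using hv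
    have h2 : v i ^ 2 ≤ (N : ℤ) ^ 2 := by
      have := Finset.single_le_sum (f := fun i => v i ^ 2) (fun _ _ => sq_nonneg _)
        (Finset.mem_univ i)
      have h3 : (m : ℤ) ≤ (N : ℤ) ^ 2 := by exact_mod_cast hm
      linarith
    exact abs_le_of_sq_le_sq h2 (by positivity)
  have hsub : R ⊆ P := by
    intro v hv
    rw [Fintype.mem_piFinset]
    intro i
    rw [Finset.mem_Icc, ← abs_le]
    have := hb v hv i
    push_cast; linarith
  refine le_trans ?_ (Finset.sum_le_sum_of_subset_of_nonneg hsub fun v _ _ =>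
    mul_nonneg (hw0 v) (by split_ifs <;> positivity))
  have hge : ∀ v ∈ R, M * (9 / 16 : ℝ) ^ k ≤
      (∏ i, w (v i)) * (if (M : ℤ) ∣ ∑ i, v i ^ 2 - m then (M : ℝ) else 0) := by
    intro v hv
    have h1 : ∑ i, v i ^ 2 = (m : ℤ) := by simpa [hR] using hv
    rw [h1, sub_self, if_pos (dvd_zero _), mul_comm]
    refine mul_le_mul_of_nonneg_right ?_ (by positivity)
    have h2 : (9 / 16 : ℝ) ^ k = ∏ _i : Fin k, (9 / 16 : ℝ) := by
      rw [Finset.prod_const, Finset.card_univ, Fintype.card_fin]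
    rw [h2]
    refine Finset.prod_le_prod (fun _ _ => by norm_num) fun i _ => le_bump ?_
    have hN' : (0 : ℝ) < N := by exact_mod_cast hN
    have h3 : |(v i : ℝ)| ≤ N := by rw [← Int.cast_abs]; exact_mod_cast hb v hv i
    push_cast
    rw [abs_div, abs_of_pos (by positivity : (0 : ℝ) < 2 * N), div_le_iff₀ (by positivity)]
    linarith
  have := Finset.card_nsmul_le_sum R _ _ hge
  rw [nsmul_eq_mul] at this
  rw [hcard]
  refine le_trans (le_of_eq ?_) this
  ring

/-- A decomposition of the frequencies `t / M` into classes of major-arc denominators. -/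
theorem exists_weyl_classes {N M : ℕ} (hN : 0 < N) (hM : M.Prime) (hMN : N ^ 2 + 2 < M) :
    ∃ Q : ℕ → ℕ, (∀ t, 0 < Q t ∧ Q t ≤ N ∧ ‖weylSum (2 * N) (t / M)‖ ≤ 2000 * N / √(Q t)) ∧
      ∀ q : ℕ, 0 < q → ∑ t ∈ (Finset.range M).filter (fun t => Q t = q),
        ‖weylSum (2 * N) (t / M)‖ ^ 3 ≤ 40000000000 * N * M / √q := by
  have hN' : (0 : ℝ) < N := by exact_mod_cast hN
  have hM' : (0 : ℝ) < M := by exact_mod_cast hM.pos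
  have hw : ∀ t : ℕ, ∃ b : ℤ, ∃ q : ℕ, 0 < q ∧ q ≤ N ∧ (M : ℤ) ∣ 2 * q * t - b ∧
      ‖weylSum (2 * N) (t / M)‖ ≤
        2000 * N / √q * √((q * M / N ^ 2) / (q * M / N ^ 2 + |(b : ℝ)|)) := by
    intro t
    obtain ⟨a, q, hq, hqN, h⟩ := weyl_bound hN (t / M)
    lift q to ℕ using hq.le
    have hq0 : 0 < q := by exact_mod_cast hq
    have hq' : (0 : ℝ) < q := by exact_mod_cast hq0
    refine ⟨2 * q * t - a * M, q, hq0, by exact_mod_cast hqN, ⟨a, by ring⟩, ?_⟩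
    set b : ℝ := ((2 * q * t - a * M : ℤ) : ℝ) with hb
    have e1 : ((q : ℤ) : ℝ) * (2 * (t / M)) - a = b / M := by
      rw [hb]; push_cast; field_simp
    rw [e1, abs_div, abs_of_pos hM', Int.cast_natCast] at h
    refine (sq_le_sq₀ (norm_nonneg _) (by positivity)).1 ?_
    rw [mul_pow, div_pow, Real.sq_sqrt hq'.le, Real.sq_sqrt (by positivity)]
    have hz : 0 < (q : ℝ) * M / N ^ 2 + |b| := by positivity
    have e2 : (2000 * (N : ℝ)) ^ 2 / q * (q * M / N ^ 2 / (q * M / N ^ 2 + |b|)) =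
        4000000 * M / (q * M / N ^ 2 + |b|) := by
      field_simp; norm_num
    rw [e2, le_div_iff₀ hz]
    have e3 : (q : ℝ) * M / N ^ 2 + |b| = (q + N ^ 2 * (|b| / M)) * (M / N ^ 2) := by
      field_simp
    rw [e3, ← mul_assoc]
    refine (mul_le_mul_of_nonneg_right h (by positivity)).trans (le_of_eq ?_)
    field_simp
  choose b Q hQ0 hQN hb hS using hw
  refine ⟨Q, fun t => ⟨hQ0 t, hQN t, (hS t).trans ?_⟩, fun q hq => ?_⟩
  · refine mul_le_of_le_one_right (by positivity) (Real.sqrt_le_one.2 ?_)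
    exact div_le_one_of_le₀ (by linarith [abs_nonneg (b t : ℝ)]) (by positivity)
  have hq' : (0 : ℝ) < q := by exact_mod_cast hq
  set z : ℝ := q * M / N ^ 2 with hz
  have hz0 : 0 < z := by positivity
  set A := (Finset.range M).filter (fun t => Q t = q)
  rcases A.eq_empty_or_nonempty with hA | ⟨t₀, ht₀⟩
  · rw [hA, Finset.sum_empty]; positivity
  have hqN : q ≤ N := by
    rw [← (Finset.mem_filter.1 ht₀).2]; exact hQN t₀
  have hz1 : 1 ≤ z := by
    rw [hz, one_le_div (by positivity)]
    have h1 : (N : ℝ) ^ 2 ≤ M := by exact_mod_cast (by omega : N ^ 2 ≤ M)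
    have h2 : (1 : ℝ) ≤ q := by exact_mod_cast hq
    nlinarith
  have hcop : IsCoprime (M : ℤ) (2 * q : ℤ) := by
    have h1 : M.Coprime (2 * q) := by
      rw [hM.coprime_iff_not_dvd, hM.dvd_mul]
      rintro (h | h)
      · have := Nat.le_of_dvd two_pos h; omega
      · have := Nat.le_of_dvd hq h; nlinarith
    exact_mod_cast Nat.isCoprime_iff_coprime.2 h1
  have hinj : Set.InjOn b A := by
    intro s hs t ht hst
    have hs' := Finset.mem_filter.1 (Finset.mem_coe.1 hs)
    have ht' := Finset.mem_filter.1 (Finset.mem_coe.1 ht)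
    have h1 := hb s
    have h2 := hb t
    rw [hs'.2, hst] at h1
    rw [ht'.2] at h2
    have h3 : (M : ℤ) ∣ 2 * q * (s - t) := by
      have e : 2 * (q : ℤ) * (s - t) = 2 * q * s - b t - (2 * q * t - b t) := by ring
      exact e ▸ dvd_sub h1 h2
    have h4 := hcop.dvd_of_dvd_mul_left h3
    have h5 := Finset.mem_range.1 hs'.1
    have h6 := Finset.mem_range.1 ht'.1
    have := Int.eq_zero_of_abs_lt_dvd h4 (by rw [abs_lt]; omega)
    omega
  have h1 : ∀ t ∈ A, ‖weylSum (2 * N) (t / M)‖ ^ 3 ≤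
      (2000 * N / √q) ^ 3 * tailKernel z (b t) := by
    intro t ht
    have h := hS t
    rw [(Finset.mem_filter.1 ht).2] at h
    rw [tailKernel, ← mul_pow]
    exact pow_le_pow_left₀ (norm_nonneg _) h 3
  refine (Finset.sum_le_sum h1).trans ?_
  rw [← Finset.mul_sum, ← Finset.sum_image (f := fun k => tailKernel z k) hinj]
  have h2 := sum_tailKernel_le hz0 (A.image b)
  refine (mul_le_mul_of_nonneg_left (h2.trans (by linarith : 1 + 4 * z ≤ 5 * z))
    (by positivity)).trans (le_of_eq ?_)
  have h3 : √(q : ℝ) ^ 2 = q := Real.sq_sqrt hq'.le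
  have h4 : 0 < √(q : ℝ) := Real.sqrt_pos.2 hq'
  rw [hz, div_pow, pow_succ (√(q : ℝ)) 2, h3]
  field_simp
  norm_num

lemma sum_inv_sqrt_le (n : ℕ) : ∑ q ∈ Finset.Icc 1 n, (√(q : ℝ))⁻¹ ≤ 2 * √n := by
  induction n with
  | zero => simp
  | succ n ih =>
    rw [Finset.sum_Icc_succ_top (by omega)]
    have ha : √(n : ℝ) ^ 2 = n := Real.sq_sqrt (by positivity)
    have hb : √((n + 1 : ℕ) : ℝ) ^ 2 = n + 1 := by
      rw [Real.sq_sqrt (by positivity)]; push_cast; rfl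
    have hb0 : 0 < √((n + 1 : ℕ) : ℝ) := Real.sqrt_pos.2 (by positivity)
    set a := √(n : ℝ)
    set b := √((n + 1 : ℕ) : ℝ)
    have h : b⁻¹ ≤ 2 * (b - a) := by
      rw [inv_le_iff_one_le_mul₀ hb0]
      nlinarith [sq_nonneg (b - a)]
    linarith

lemma sum_inv_sqrt_cube_le (n : ℕ) : ∑ q ∈ Finset.Icc 1 n, (√(q : ℝ))⁻¹ ^ 3 ≤ 3 := by
  suffices h : ∀ n : ℕ, ∑ q ∈ Finset.Icc 1 (n + 1), (√(q : ℝ))⁻¹ ^ 3 ≤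
      3 - 2 * (√((n + 1 : ℕ) : ℝ))⁻¹ by
    rcases n with _ | n
    · simp
    · have : 0 ≤ (√((n + 1 : ℕ) : ℝ))⁻¹ := by positivity
      linarith [h n]
  intro n
  induction n with
  | zero => simp; norm_num
  | succ n ih =>
    rw [Finset.sum_Icc_succ_top (by omega)]
    have ha : √((n + 1 : ℕ) : ℝ) ^ 2 = n + 1 := by
      rw [Real.sq_sqrt (by positivity)]; push_cast; rfl
    have hb : √((n + 1 + 1 : ℕ) : ℝ) ^ 2 = n + 1 + 1 := by
      rw [Real.sq_sqrt (by positivity)]; push_cast; rfl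
    have ha0 : 0 < √((n + 1 : ℕ) : ℝ) := Real.sqrt_pos.2 (by positivity)
    have hb0 : 0 < √((n + 1 + 1 : ℕ) : ℝ) := Real.sqrt_pos.2 (by positivity)
    set a := √((n + 1 : ℕ) : ℝ)
    set b := √((n + 1 + 1 : ℕ) : ℝ)
    have hab : a ≤ b := by nlinarith
    have h1 : (b - a) * (b + a) = 1 := by nlinarith
    have h : b⁻¹ ^ 3 ≤ 2 * a⁻¹ - 2 * b⁻¹ := by
      have e : 2 * a⁻¹ - 2 * b⁻¹ = 2 * (b - a) / (a * b) := by field_simp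
      rw [e, inv_pow, ← one_div, div_le_div_iff₀ (by positivity) (by positivity)]
      have h2 : a ≤ 2 * (b - a) * b ^ 2 := by
        have h3 : 2 * (b - a) * b ^ 2 * (b + a) = 2 * b ^ 2 := by
          linear_combination 2 * b ^ 2 * h1
        have h4 : a * (b + a) ≤ 2 * b ^ 2 := by nlinarith
        exact le_of_mul_le_mul_right (by linarith) (by positivity : 0 < b + a)
      nlinarith
    linarith

lemma sum_weylSum_pow_le {N M : ℕ} {Q : ℕ → ℕ}
    (hQ : ∀ t, 0 < Q t ∧ Q t ≤ N ∧ ‖weylSum (2 * N) (t / M)‖ ≤ 2000 * N / √(Q t))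
    (hQ3 : ∀ q : ℕ, 0 < q → ∑ t ∈ (Finset.range M).filter (fun t => Q t = q),
        ‖weylSum (2 * N) (t / M)‖ ^ 3 ≤ 40000000000 * N * M / √q)
    (I : Finset ℕ) (hI : ∀ q ∈ I, 0 < q) (j : ℕ) :
    ∑ t ∈ (Finset.range M).filter (fun t => Q t ∈ I), ‖weylSum (2 * N) (t / M)‖ ^ (3 + j) ≤
      40000000000 * N * M * (2000 * N) ^ j * ∑ q ∈ I, (√(q : ℝ))⁻¹ ^ (j + 1) := by
  rw [← Finset.sum_fiberwise_of_maps_to (g := Q) (t := I)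
    (fun t ht => (Finset.mem_filter.1 ht).2), Finset.mul_sum]
  refine Finset.sum_le_sum fun q hq => ?_
  have hq0 : (0 : ℝ) < √q := Real.sqrt_pos.2 (by exact_mod_cast hI q hq)
  have hsub : ((Finset.range M).filter (fun t => Q t ∈ I)).filter (fun t => Q t = q) ⊆
      (Finset.range M).filter (fun t => Q t = q) :=
    Finset.filter_subset_filter _ (Finset.filter_subset _ _)
  refine (Finset.sum_le_sum_of_subset_of_nonneg hsub fun _ _ _ => by positivity).trans ?_
  have h : ∀ t ∈ (Finset.range M).filter (fun t => Q t = q),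
      ‖weylSum (2 * N) (t / M)‖ ^ (3 + j) ≤
        (2000 * N / √q) ^ j * ‖weylSum (2 * N) (t / M)‖ ^ 3 := by
    intro t ht
    have h1 := (hQ t).2.2
    rw [(Finset.mem_filter.1 ht).2] at h1
    rw [pow_add, mul_comm]
    exact mul_le_mul_of_nonneg_right (pow_le_pow_left₀ (norm_nonneg _) h1 j) (by positivity)
  refine (Finset.sum_le_sum h).trans ?_
  rw [← Finset.mul_sum]
  refine (mul_le_mul_of_nonneg_left (hQ3 q (hI q hq)) (by positivity)).trans (le_of_eq ?_)
  rw [div_eq_mul_inv, div_eq_mul_inv, mul_pow, pow_succ]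
  ring

lemma exists_prime_modulus (N : ℕ) : ∃ M : ℕ, M.Prime ∧ N ^ 2 + 2 < M := by
  obtain ⟨M, h1, h2⟩ := Nat.exists_infinite_primes (N ^ 2 + 3)
  exact ⟨M, h2, by omega⟩

lemma norm_sum_mul_expi_le (T : Finset ℕ) (a : ℕ → ℂ) (x : ℕ → ℝ) :
    ‖∑ t ∈ T, a t * expi (x t)‖ ≤ ∑ t ∈ T, ‖a t‖ :=
  norm_sum_le_of_le _ fun t _ => by rw [norm_mul, norm_expi, mul_one]

theorem rep_five_upper : ∃ C : ℝ, 0 < C ∧ ∀ N : ℕ, 0 < N → ∀ m : ℕ, m ≤ N ^ 2 →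
    (rep 5 m : ℝ) ≤ C * N ^ 3 := by
  refine ⟨(16 / 9) ^ 5 * (40000000000 * 2000 ^ 2 * 3), by positivity, fun N hN m hm => ?_⟩
  obtain ⟨M, hM, hMN⟩ := exists_prime_modulus N
  obtain ⟨Q, hQ, hQ3⟩ := exists_weyl_classes hN hM hMN
  have hM' : (0 : ℝ) < M := by exact_mod_cast hM.pos
  have h1 := (rep_le_norm_sum_weylSum hN hM.pos 5 hm).trans (norm_sum_mul_expi_le _ _ _)
  simp only [norm_pow] at h1
  have h2 := sum_weylSum_pow_le hQ hQ3 (Finset.Icc 1 N)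
    (fun q hq => (Finset.mem_Icc.1 hq).1) 2
  rw [Finset.filter_true_of_mem fun t _ => Finset.mem_Icc.2 ⟨(hQ t).1, (hQ t).2.1⟩] at h2
  have h3 : 40000000000 * N * M * (2000 * N) ^ 2 * ∑ q ∈ Finset.Icc 1 N, (√(q : ℝ))⁻¹ ^ (2 + 1) ≤
      40000000000 * N * M * (2000 * N) ^ 2 * 3 :=
    mul_le_mul_of_nonneg_left (sum_inv_sqrt_cube_le N) (by positivity)
  have h4 := h1.trans (h2.trans h3)
  have h5 : (9 / 16 : ℝ) ^ 5 * rep 5 m ≤ 40000000000 * 2000 ^ 2 * 3 * N ^ 3 := by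
    refine le_of_mul_le_mul_left (h4.trans (le_of_eq ?_)) hM'
    ring
  have h6 : (rep 5 m : ℝ) = (16 / 9) ^ 5 * ((9 / 16 : ℝ) ^ 5 * rep 5 m) := by
    rw [← mul_assoc, ← mul_pow]; norm_num
  rw [h6, mul_assoc ((16 / 9 : ℝ) ^ 5)]
  exact mul_le_mul_of_nonneg_left h5 (by positivity)

/-- The third moment of the number of representations by three squares. -/
theorem sum_rep_three_cube_le : ∃ C : ℝ, 0 < C ∧ ∀ N : ℕ, 0 < N →
    ∑ m ∈ Finset.range (N ^ 2 + 1), (rep 3 m : ℝ) ^ 3 ≤ C * N ^ 5 := by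
  obtain ⟨c, hc0, hc⟩ : ∃ c : ℝ, 0 < c ∧ c = 40000000000 * 2 := ⟨_, by norm_num, rfl⟩
  obtain ⟨D, hD0, hD⟩ : ∃ D : ℝ, 0 < D ∧ D = 40000000000 * 2000 ^ 3 := ⟨_, by norm_num, rfl⟩
  refine ⟨(16 / 9) ^ 9 * (16 * c ^ 3 + 32 * c * D), by positivity, fun N hN => ?_⟩
  obtain ⟨M, hM, hMN⟩ := exists_prime_modulus N
  obtain ⟨Q, hQ, hQ3⟩ := exists_weyl_classes hN hM hMN
  have hN' : (1 : ℝ) ≤ N := by exact_mod_cast hN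
  have hM' : (0 : ℝ) < M := by exact_mod_cast hM.pos
  set S : ℕ → ℂ := fun t => weylSum (2 * N) (t / M) ^ 3 with hS
  set T : ℕ → Finset ℕ := fun j => (Finset.range M).filter fun t => Q t ∈ Finset.Icc 1 (4 ^ j)
  set T' : ℕ → Finset ℕ := fun j => (Finset.range M).filter fun t => Q t ∈ Finset.Ioc (4 ^ j) N
  set E : ℕ → ℕ → ℝ := fun j m => ‖∑ t ∈ T' j, S t * expi (m * (-t / M))‖ / M with hE
  set y : ℕ → ℝ := fun m => (9 / 16 : ℝ) ^ 3 * rep 3 m with hy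
  have hmajor : ∀ j m, ‖∑ t ∈ T j, S t * expi (m * (-t / M))‖ ≤ M * (c * N * 2 ^ j) := by
    intro j m
    refine (norm_sum_mul_expi_le _ _ _).trans ?_
    have h2 := sum_weylSum_pow_le hQ hQ3 (Finset.Icc 1 (4 ^ j))
      (fun q hq => (Finset.mem_Icc.1 hq).1) 0
    simp only [hS, norm_pow]
    refine h2.trans ?_
    have h3 := sum_inv_sqrt_le (4 ^ j)
    have h4 : √((4 ^ j : ℕ) : ℝ) = 2 ^ j := by
      rw [Real.sqrt_eq_iff_mul_self_eq (by positivity) (by positivity), ← mul_pow]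
      push_cast; norm_num
    rw [h4] at h3
    simp only [zero_add, pow_one, pow_zero, mul_one]
    refine (mul_le_mul_of_nonneg_left h3 (by positivity)).trans (le_of_eq ?_)
    rw [hc]; ring
  have hminor : ∀ j, ∑ m ∈ Finset.range (N ^ 2 + 1), E j m ^ 2 ≤ D * N ^ 4 / 4 ^ j := by
    intro j
    have h1 : ∑ m ∈ Finset.range (N ^ 2 + 1), E j m ^ 2 ≤ ∑ m ∈ Finset.range M, E j m ^ 2 :=
      Finset.sum_le_sum_of_subset_of_nonneg (Finset.range_subset_range.2 (by omega))
        fun _ _ _ => by positivity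
    refine h1.trans ?_
    simp only [hE, div_pow]
    rw [← Finset.sum_div, sum_norm_sq_expi hM.pos (Finset.filter_subset _ _)]
    have h2 := sum_weylSum_pow_le hQ hQ3 (Finset.Ioc (4 ^ j) N)
      (fun q hq => (Nat.zero_le _).trans_lt (Finset.mem_Ioc.1 hq).1) 3
    have h3 : ∑ q ∈ Finset.Ioc (4 ^ j) N, (√(q : ℝ))⁻¹ ^ (3 + 1) ≤ ((4 : ℝ) ^ j)⁻¹ := by
      have e : ∀ q : ℕ, (√(q : ℝ))⁻¹ ^ (3 + 1) = ((q : ℝ) ^ 2)⁻¹ := by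
        intro q
        rw [inv_pow, show 3 + 1 = 2 * 2 from rfl, pow_mul, Real.sq_sqrt (by positivity)]
      simp only [e]
      by_cases hle : 4 ^ j ≤ N
      · have h := sum_Ioc_inv_sq_le_sub (α := ℝ) (k := 4 ^ j) (n := N) (by positivity) hle
        have : (0 : ℝ) ≤ (N : ℝ)⁻¹ := by positivity
        push_cast at h
        linarith
      · rw [Finset.Ioc_eq_empty (by omega), Finset.sum_empty]; positivity
    have h4 : ∀ t, ‖S t‖ ^ 2 = ‖weylSum (2 * N) (t / M)‖ ^ (3 + 3) := by
      intro t; simp only [hS, norm_pow]; rw [← pow_mul]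
    simp only [h4]
    have h5 := h2.trans (mul_le_mul_of_nonneg_left h3 (by positivity))
    rw [div_le_iff₀ (by positivity)]
    refine (mul_le_mul_of_nonneg_left h5 hM'.le).trans (le_of_eq ?_)
    rw [hD]; ring
  have hsplit : ∀ j, ∀ m ∈ Finset.range (N ^ 2 + 1), y m ≤ c * N * 2 ^ j + E j m := by
    intro j m hm
    have h1 := rep_le_norm_sum_weylSum hN hM.pos 3 (Nat.lt_succ_iff.1 (Finset.mem_range.1 hm))
    have h2 : Finset.range M = T j ∪ T' j := by
      rw [← Finset.filter_or]
      refine (Finset.filter_true_of_mem fun t _ => ?_).symm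
      have := hQ t
      rw [Finset.mem_Icc, Finset.mem_Ioc]; omega
    have h3 : Disjoint (T j) (T' j) := by
      refine Finset.disjoint_filter.2 fun t _ => ?_
      rw [Finset.mem_Icc, Finset.mem_Ioc]; omega
    rw [h2, Finset.sum_union h3] at h1
    have h4 := h1.trans ((norm_add_le _ _).trans (add_le_add_left (hmajor j m) _))
    have h5 : M * (c * N * 2 ^ j) + ‖∑ t ∈ T' j, S t * expi (m * (-t / M))‖ =
        M * (c * N * 2 ^ j + E j m) := by
      simp only [hE]; field_simp
    exact le_of_mul_le_mul_left (h4.trans_eq h5) hM'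
  have hpoint : ∀ m ∈ Finset.range (N ^ 2 + 1), y m ^ 3 ≤ 8 * c ^ 3 * N ^ 3 +
      ∑ j ∈ Finset.range N, 16 * c * N * 2 ^ j * E j m ^ 2 := by
    intro m hm
    have hE0 : ∀ j, 0 ≤ E j m := fun j => by positivity
    have hy0 : 0 ≤ y m := by positivity
    have hsum0 : 0 ≤ ∑ j ∈ Finset.range N, 16 * c * N * 2 ^ j * E j m ^ 2 :=
      Finset.sum_nonneg fun j _ => by positivity
    by_cases hsmall : y m ≤ 2 * c * N
    · have := pow_le_pow_left₀ hy0 hsmall 3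
      nlinarith
    push Not at hsmall
    have hex : ∃ j : ℕ, y m ≤ 2 * c * N * 2 ^ j := by
      refine ⟨N, ?_⟩
      have h1 := hsplit N m hm
      have h2 : E N m = 0 := by
        have : T' N = ∅ := by
          have h4 : N < 4 ^ N := Nat.lt_pow_self (by norm_num)
          refine Finset.filter_false_of_mem fun t _ => ?_
          rw [Finset.mem_Ioc]; omega
        simp [hE, this]
      rw [h2, add_zero] at h1
      nlinarith [show 0 < c * N * 2 ^ N by positivity]
    classical
    obtain ⟨j, hj⟩ : ∃ j, Nat.find hex = j + 1 := by
      refine Nat.exists_eq_succ_of_ne_zero fun h0 => ?_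
      have := Nat.find_spec hex
      rw [h0] at this
      linarith
    have hj1 : y m ≤ 2 * c * N * 2 ^ (j + 1) := hj ▸ Nat.find_spec hex
    have hj2 : 2 * c * N * 2 ^ j < y m := not_le.1 (Nat.find_min hex (by omega : j < _))
    have hjE := hsplit j m hm
    have hjN : j < N := by
      by_contra hle
      have h2 : E j m = 0 := by
        have : T' j = ∅ := by
          have h4 : j < 4 ^ j := Nat.lt_pow_self (by norm_num)
          refine Finset.filter_false_of_mem fun t _ => ?_
          rw [Finset.mem_Ioc]; omega
        simp [hE, this]
      nlinarith [show 0 < c * N * 2 ^ j by positivity]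
    have h1 : y m ≤ 2 * E j m := by linarith
    have h2 : y m ^ 3 ≤ 16 * c * N * 2 ^ j * E j m ^ 2 := by
      have h3 : y m ^ 2 ≤ (2 * E j m) ^ 2 := pow_le_pow_left₀ hy0 h1 2
      calc y m ^ 3 = y m * y m ^ 2 := by ring
        _ ≤ (2 * c * N * 2 ^ (j + 1)) * (2 * E j m) ^ 2 :=
            mul_le_mul hj1 h3 (by positivity) (by positivity)
        _ = _ := by ring
    have h3 := Finset.single_le_sum (f := fun j => 16 * c * N * 2 ^ j * E j m ^ 2)
      (fun j _ => by positivity) (Finset.mem_range.2 hjN)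
    have h4 : 0 ≤ 8 * c ^ 3 * (N : ℝ) ^ 3 := by positivity
    linarith
  have htot : ∑ m ∈ Finset.range (N ^ 2 + 1), y m ^ 3 ≤ (16 * c ^ 3 + 32 * c * D) * N ^ 5 := by
    refine (Finset.sum_le_sum hpoint).trans ?_
    rw [Finset.sum_add_distrib, Finset.sum_const, Finset.card_range, nsmul_eq_mul,
      Finset.sum_comm]
    have h1 : ∀ j, ∑ m ∈ Finset.range (N ^ 2 + 1), 16 * c * N * 2 ^ j * E j m ^ 2 ≤
        16 * c * D * N ^ 5 * (1 / 2) ^ j := by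
      intro j
      rw [← Finset.mul_sum]
      refine (mul_le_mul_of_nonneg_left (hminor j) (by positivity)).trans (le_of_eq ?_)
      rw [show (4 : ℝ) = 2 * 2 by norm_num, mul_pow, one_div, inv_pow]
      field_simp
    have h2 := Finset.sum_le_sum fun j (_ : j ∈ Finset.range N) => h1 j
    rw [← Finset.mul_sum] at h2
    have h3 : ∑ j ∈ Finset.range N, (1 / 2 : ℝ) ^ j ≤ 2 := by
      have h4 : (0 : ℝ) ≤ (1 / 2) ^ N := by positivity
      have h5 := geom_sum_mul (1 / 2 : ℝ) N
      linarith
    have h4 := mul_le_mul_of_nonneg_left h3 (show 0 ≤ 16 * c * D * (N : ℝ) ^ 5 by positivity)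
    have h5 : ((N ^ 2 + 1 : ℕ) : ℝ) * (8 * c ^ 3 * N ^ 3) ≤ 16 * c ^ 3 * N ^ 5 := by
      have : ((N ^ 2 + 1 : ℕ) : ℝ) ≤ 2 * N ^ 2 := by push_cast; nlinarith
      refine (mul_le_mul_of_nonneg_right this (by positivity)).trans (le_of_eq (by ring))
    linarith
  have hfin : ∀ m : ℕ, (rep 3 m : ℝ) ^ 3 = (16 / 9) ^ 9 * y m ^ 3 := by
    intro m
    simp only [hy]
    rw [mul_pow, ← pow_mul, ← mul_assoc, ← mul_pow]; norm_num
  simp only [hfin]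
  rw [← Finset.mul_sum, mul_assoc ((16 / 9 : ℝ) ^ 9)]
  exact mul_le_mul_of_nonneg_left htot (by positivity)

/-- The number of representations by at least five squares has its expected size. -/
theorem rep_upper (K : ℕ) (hK : 5 ≤ K) : ∃ C : ℕ, ∀ N : ℕ, 0 < N → ∀ m : ℤ, m ≤ (N : ℤ) ^ 2 →
    rep K m ≤ C * N ^ (K - 2) := by
  induction K, hK using Nat.le_induction with
  | base =>
    obtain ⟨C, -, hC⟩ := rep_five_upper
    refine ⟨⌈C⌉₊, fun N hN m hm => ?_⟩
    rcases lt_or_ge m 0 with h | h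
    · simp [rep_eq_zero_of_neg 5 h]
    · lift m to ℕ using h
      have h1 := hC N hN m (by exact_mod_cast hm)
      have h2 : C * (N : ℝ) ^ 3 ≤ ⌈C⌉₊ * (N : ℝ) ^ 3 :=
        mul_le_mul_of_nonneg_right (Nat.le_ceil C) (by positivity)
      exact_mod_cast h1.trans h2
  | succ K hK ih =>
    obtain ⟨C, hC⟩ := ih
    refine ⟨3 * C, fun N hN m hm => ?_⟩
    refine (rep_succ_le K hm).trans ?_
    refine (Finset.sum_le_card_nsmul _ _ _ fun a _ =>
      hC N hN (m - a ^ 2) (by nlinarith [sq_nonneg a])).trans ?_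
    rw [Int.card_Icc, smul_eq_mul, show K + 1 - 2 = K - 2 + 1 by omega, pow_succ]
    have h1 : ((N : ℤ) + 1 - -N).toNat ≤ 3 * N := by omega
    calc ((N : ℤ) + 1 - -N).toNat * (C * N ^ (K - 2)) ≤ 3 * N * (C * N ^ (K - 2)) :=
          Nat.mul_le_mul_right _ h1
      _ = _ := by ring

lemma sum_range_shift_le (g : ℤ → ℕ) (hg : ∀ m < 0, g m = 0) (n b : ℕ) :
    ∑ m ∈ Finset.range n, g (m - b) ≤ ∑ m ∈ Finset.range n, g m := by
  rw [← Finset.sum_filter_of_ne (p := fun m => b ≤ m) (fun m _ h => by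
    by_contra hlt
    exact h (hg _ (by omega)))]
  have h1 : ∑ m ∈ (Finset.range n).filter (b ≤ ·), g (m - b) =
      ∑ m ∈ ((Finset.range n).filter (b ≤ ·)).image (· - b), g m := by
    rw [Finset.sum_image]
    · refine Finset.sum_congr rfl fun m hm => ?_
      rw [Nat.cast_sub (Finset.mem_filter.1 hm).2]
    · intro x hx y hy hxy
      have hx' := (Finset.mem_filter.1 (Finset.mem_coe.1 hx)).2
      have hy' := (Finset.mem_filter.1 (Finset.mem_coe.1 hy)).2
      simp only at hxy
      omega
  rw [h1]
  refine Finset.sum_le_sum_of_subset fun m hm => ?_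
  simp only [Finset.mem_image, Finset.mem_filter, Finset.mem_range] at hm ⊢
  omega

/-- The third moment of the number of representations by three or four squares. -/
theorem sum_rep_cube_le (d : ℕ) (hd : 3 ≤ d) (hd' : d ≤ 4) : ∃ C : ℕ, ∀ N : ℕ, 0 < N →
    ∑ m ∈ Finset.range (N ^ 2 + 1), rep d m ^ 3 ≤ C * N ^ (3 * d - 4) := by
  have h3 : ∃ C : ℕ, ∀ N : ℕ, 0 < N →
      ∑ m ∈ Finset.range (N ^ 2 + 1), rep 3 m ^ 3 ≤ C * N ^ 5 := by
    obtain ⟨C, -, hC⟩ := sum_rep_three_cube_le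
    refine ⟨⌈C⌉₊, fun N hN => ?_⟩
    have h2 : C * (N : ℝ) ^ 5 ≤ ⌈C⌉₊ * (N : ℝ) ^ 5 :=
      mul_le_mul_of_nonneg_right (Nat.le_ceil C) (by positivity)
    exact_mod_cast (hC N hN).trans h2
  obtain rfl | rfl : d = 3 ∨ d = 4 := by omega
  · exact h3
  obtain ⟨C, hC⟩ := h3
  refine ⟨27 * C, fun N hN => ?_⟩
  have hcard : (Finset.Icc (-(N : ℤ)) N).card ≤ 3 * N := by
    rw [Int.card_Icc]; omega
  have h1 : ∀ m ∈ Finset.range (N ^ 2 + 1), rep 4 m ^ 3 ≤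
      (3 * N) ^ 2 * ∑ a ∈ Finset.Icc (-(N : ℤ)) N, rep 3 (m - a ^ 2) ^ 3 := by
    intro m hm
    have hm' : (m : ℤ) ≤ (N : ℤ) ^ 2 := by
      have := Nat.lt_succ_iff.1 (Finset.mem_range.1 hm)
      exact_mod_cast this
    refine (Nat.pow_le_pow_left (rep_succ_le 3 hm') 3).trans ?_
    refine le_trans ?_ (Nat.mul_le_mul_right _ (Nat.pow_le_pow_left hcard 2))
    exact pow_sum_le_card_mul_sum_pow (fun _ _ => Nat.zero_le _) 2
  refine (Finset.sum_le_sum h1).trans ?_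
  rw [← Finset.mul_sum, Finset.sum_comm]
  have h2 : ∀ a ∈ Finset.Icc (-(N : ℤ)) N,
      ∑ m ∈ Finset.range (N ^ 2 + 1), rep 3 (m - a ^ 2) ^ 3 ≤ C * N ^ 5 := by
    intro a _
    refine le_trans ?_ (hC N hN)
    have := sum_range_shift_le (fun m => rep 3 m ^ 3)
      (fun m hm => by simp [rep_eq_zero_of_neg 3 hm]) (N ^ 2 + 1) (a.natAbs ^ 2)
    simpa using this
  have h4 := (Finset.sum_le_card_nsmul _ _ _ h2).trans (Nat.mul_le_mul_right _ hcard)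
  refine (Nat.mul_le_mul_left _ h4).trans (le_of_eq ?_)
  ring

lemma card_sum_sq_eq_rep (n d : ℕ) (m : ℤ) :
    Nat.card {v : Fin n → V d // ∑ j, ∑ i, v j i ^ 2 = m} = rep (n * d) m := by
  refine Nat.card_congr (Equiv.subtypeEquiv
    ((Equiv.curry (Fin n) (Fin d) ℤ).symm.trans
      (Equiv.arrowCongr finProdFinEquiv (Equiv.refl ℤ))) fun v => ?_)
  rw [← Fintype.sum_prod_type', ← finProdFinEquiv.symm.sum_comp]
  rfl

instance (n d : ℕ) (m : ℤ) : Finite {v : Fin n → V d // ∑ j, ∑ i, v j i ^ 2 = m} :=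
  Finite.of_equiv {v : Fin n × Fin d → ℤ // ∑ i, v i ^ 2 = m}
    (Equiv.subtypeEquiv (Equiv.curry (Fin n) (Fin d) ℤ) fun v => by
      rw [Fintype.sum_prod_type]; rfl)

lemma NcountM_eq_rep (l d lam : ℕ) : NcountM l d lam = rep (l * d) lam :=
  card_sum_sq_eq_rep l d lam

lemma tsum_sphM_last_le (n d lam : ℕ) (h : V d → ℝ≥0∞) :
    ∑' u : sphM (n + 1) d lam, h ((u : Fin (n + 1) → V d) (Fin.last n)) ≤
      ∑' w : V d, (rep (n * d) (lam - ∑ i, w i ^ 2) : ℝ≥0∞) * h w := by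
  set φ : sphM (n + 1) d lam → V d := fun u => (u : Fin (n + 1) → V d) (Fin.last n)
  rw [← (Equiv.sigmaFiberEquiv φ).tsum_eq, ENNReal.tsum_sigma']
  refine ENNReal.tsum_le_tsum fun w => ?_
  have h1 : ∀ u : {u // φ u = w}, h (φ (Equiv.sigmaFiberEquiv φ ⟨w, u⟩)) = h w := fun u => by
    rw [Equiv.sigmaFiberEquiv_apply, u.2]
  rw [tsum_congr h1, ENNReal.tsum_const]
  refine mul_le_mul_left ?_ _
  let ψ : {u // φ u = w} →
      {v : Fin n → V d // ∑ j, ∑ i, v j i ^ 2 = (lam : ℤ) - ∑ i, w i ^ 2} := fun u =>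
    ⟨fun j => (u.1 : Fin (n + 1) → V d) j.castSucc, by
      have h2 : ∑ j, ∑ i, (u.1 : Fin (n + 1) → V d) j i ^ 2 = (lam : ℤ) := u.1.2
      have h3 : (u.1 : Fin (n + 1) → V d) (Fin.last n) = w := u.2
      rw [Fin.sum_univ_castSucc, h3] at h2
      linarith⟩
  have hψ : Function.Injective ψ := by
    intro u v huv
    apply Subtype.ext
    apply Subtype.ext
    funext j
    have h2 := congrArg Subtype.val huv
    refine Fin.lastCases ?_ (fun i => congrFun h2 i) j
    exact u.2.trans v.2.symm
  have : Finite {u // φ u = w} := Finite.of_injective ψ hψ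
  rw [← card_sum_sq_eq_rep, ENat.card_eq_coe_natCard]
  exact_mod_cast Nat.card_le_card_of_injective ψ hψ

lemma enorm_avgM_le (n d lam : ℕ) (hN : 0 < NcountM (n + 1) d lam)
    (f : Fin (n + 1) → V d → ℂ) (x : V d) :
    (‖avgM (n + 1) d lam f x‖₊ : ℝ≥0∞) ≤ (∏ j : Fin n, linftyNorm d (f j.castSucc)) *
      ((∑' w : V d, (rep (n * d) (lam - ∑ i, w i ^ 2) : ℝ≥0∞) *
        (‖f (Fin.last n) (x - w)‖₊ : ℝ≥0∞)) / rep ((n + 1) * d) lam) := by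
  set P := ∏ j : Fin n, linftyNorm d (f j.castSucc)
  have hfin : Finite (sphM (n + 1) d lam) :=
    inferInstanceAs (Finite {v : Fin (n + 1) → V d // ∑ j, ∑ i, v j i ^ 2 = (lam : ℤ)})
  have := Fintype.ofFinite (sphM (n + 1) d lam)
  have h1 : (‖∑' u : sphM (n + 1) d lam, ∏ j, f j (x - (u : Fin (n + 1) → V d) j)‖₊ : ℝ≥0∞) ≤
      ∑' u : sphM (n + 1) d lam,
        P * (‖f (Fin.last n) (x - (u : Fin (n + 1) → V d) (Fin.last n))‖₊ : ℝ≥0∞) := by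
    rw [tsum_fintype, tsum_fintype]
    refine (ENNReal.coe_le_coe.2 (nnnorm_sum_le _ _)).trans ?_
    rw [ENNReal.ofNNReal_finsetSum]
    refine Finset.sum_le_sum fun u _ => ?_
    rw [Fin.prod_univ_castSucc, nnnorm_mul, nnnorm_prod, ENNReal.coe_mul, ENNReal.ofNNReal_finsetProd]
    refine mul_le_mul_left (Finset.prod_le_prod' fun j _ => ?_) _
    exact le_iSup (fun y => (‖f j.castSucc y‖₊ : ℝ≥0∞)) _
  rw [ENNReal.tsum_mul_left] at h1
  have h2 := tsum_sphM_last_le n d lam fun w => (‖f (Fin.last n) (x - w)‖₊ : ℝ≥0∞)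
  have h3 := h1.trans (mul_le_mul_right h2 P)
  have h4 : ((‖((NcountM (n + 1) d lam : ℂ))⁻¹‖₊ : ℝ≥0) : ℝ≥0∞) =
      (rep ((n + 1) * d) lam : ℝ≥0∞)⁻¹ := by
    rw [nnnorm_inv, ← NcountM_eq_rep, RCLike.nnnorm_natCast,
      ENNReal.coe_inv (by exact_mod_cast hN.ne'), ENNReal.coe_natCast]
  rw [avgM, nnnorm_mul, ENNReal.coe_mul, h4, div_eq_mul_inv, ← mul_assoc, mul_comm]
  exact mul_le_mul_left h3 _

lemma sum_cube_le_hlMax (d N : ℕ) (g : V d → ℝ≥0∞) (x : V d) :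
    ∑ u ∈ cube d N, g (x - u) ≤ (2 * N + 1 : ℝ≥0∞) ^ d * hlMax d g x := by
  have h := le_iSup (fun N : ℕ => ((2 * N + 1 : ℝ≥0∞) ^ d)⁻¹ * ∑ u ∈ cube d N, g (x - u)) N
  rwa [ENNReal.inv_mul_le_iff (by positivity)
    (ENNReal.pow_ne_top (by exact_mod_cast ENNReal.natCast_ne_top (2 * N + 1)))] at h

lemma rep_eq_zero_of_notMem_cube {k d N lam : ℕ} (hlam : lam ≤ N ^ 2) {w : V d}
    (hw : w ∉ cube d N) : rep k (lam - ∑ i, w i ^ 2) = 0 := by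
  apply rep_eq_zero_of_neg
  rw [mem_cube] at hw
  push Not at hw
  obtain ⟨i, hi⟩ := hw
  have h1 := Finset.single_le_sum (f := fun i => w i ^ 2) (fun _ _ => sq_nonneg _)
    (Finset.mem_univ i)
  have h2 : (lam : ℤ) ≤ (N : ℤ) ^ 2 := by exact_mod_cast hlam
  have h3 : (N : ℤ) ^ 2 < w i ^ 2 := by
    rw [← sq_abs (w i)]
    exact pow_lt_pow_left₀ hi (by positivity) two_ne_zero
  linarith

lemma tsum_rep_eq_sum_cube {k d N lam : ℕ} (hlam : lam ≤ N ^ 2) (h : V d → ℝ≥0∞) :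
    ∑' w : V d, (rep k (lam - ∑ i, w i ^ 2) : ℝ≥0∞) * h w =
      ∑ w ∈ cube d N, (rep k (lam - ∑ i, w i ^ 2) : ℝ≥0∞) * h w :=
  tsum_eq_sum fun w hw => by rw [rep_eq_zero_of_notMem_cube hlam hw, Nat.cast_zero, zero_mul]

lemma le_succ_sqrt_sq (lam : ℕ) : lam ≤ (Nat.sqrt lam + 1) ^ 2 := by
  rw [sq]; exact (Nat.lt_succ_sqrt lam).le

/-- Pointwise domination of the averages when the remaining variables span at least five
dimensions. -/
lemma weighted_average_le_hlMax (k d : ℕ) (hk : 5 ≤ k) : ∃ C : ℕ, ∀ (g : V d → ℝ≥0∞) (lam : ℕ)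
    (x : V d), (∑' w : V d, (rep k (lam - ∑ i, w i ^ 2) : ℝ≥0∞) * g (x - w)) / rep (k + d) lam ≤
      C * hlMax d g x := by
  obtain ⟨C₀, h₀⟩ := rep_lower (k + d) (by omega)
  obtain ⟨C₁, h₁⟩ := rep_upper k hk
  refine ⟨C₁ * 3 ^ d * C₀, fun g lam x => ENNReal.div_le_of_le_mul ?_⟩
  set N := Nat.sqrt lam + 1 with hN
  have hlam : lam ≤ N ^ 2 := le_succ_sqrt_sq lam
  rw [tsum_rep_eq_sum_cube hlam fun w => g (x - w)]
  have h2 : ∀ w ∈ cube d N, (rep k (lam - ∑ i, w i ^ 2) : ℝ≥0∞) * g (x - w) ≤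
      ((C₁ * N ^ (k - 2) : ℕ) : ℝ≥0∞) * g (x - w) := by
    intro w _
    refine mul_le_mul_left ?_ _
    have h3 : (0 : ℤ) ≤ ∑ i, w i ^ 2 := Finset.sum_nonneg fun _ _ => sq_nonneg _
    have h4 : (lam : ℤ) ≤ (N : ℤ) ^ 2 := by exact_mod_cast hlam
    exact_mod_cast h₁ N (by omega) _ (by linarith)
  refine (Finset.sum_le_sum h2).trans ?_
  rw [← Finset.mul_sum]
  refine (mul_le_mul_right (sum_cube_le_hlMax d N g x) _).trans ?_
  have h5 : C₁ * N ^ (k - 2) * (2 * N + 1) ^ d ≤ C₁ * 3 ^ d * C₀ * rep (k + d) lam := by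
    calc C₁ * N ^ (k - 2) * (2 * N + 1) ^ d ≤ C₁ * N ^ (k - 2) * (3 * N) ^ d :=
          Nat.mul_le_mul_left _ (Nat.pow_le_pow_left (by omega) d)
      _ = C₁ * 3 ^ d * N ^ (k + d - 2) := by
          rw [show k + d - 2 = k - 2 + d by omega, mul_pow, pow_add]; ring
      _ ≤ C₁ * 3 ^ d * (C₀ * rep (k + d) lam) := Nat.mul_le_mul_left _ (h₀ lam)
      _ = _ := by ring
  have h6 : ((C₁ * N ^ (k - 2) * (2 * N + 1) ^ d : ℕ) : ℝ≥0∞) ≤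
      ((C₁ * 3 ^ d * C₀ * rep (k + d) lam : ℕ) : ℝ≥0∞) := by exact_mod_cast h5
  calc ((C₁ * N ^ (k - 2) : ℕ) : ℝ≥0∞) * ((2 * N + 1) ^ d * hlMax d g x)
      = ((C₁ * N ^ (k - 2) * (2 * N + 1) ^ d : ℕ) : ℝ≥0∞) * hlMax d g x := by
        push_cast; ring
    _ ≤ ((C₁ * 3 ^ d * C₀ * rep (k + d) lam : ℕ) : ℝ≥0∞) * hlMax d g x :=
        mul_le_mul_left h6 _
    _ = _ := by push_cast; ring

lemma sum_cube_rep_sq_le (d lam N : ℕ) (hlam : lam ≤ N ^ 2) :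
    ∑ w ∈ cube d N, rep d (lam - ∑ i, w i ^ 2) ^ 2 ≤
      2 * ∑ m ∈ Finset.range (N ^ 2 + 1), rep d m ^ 3 := by
  classical
  set s : V d → ℕ := fun w => (∑ i, w i ^ 2).toNat with hs
  have hs' : ∀ w : V d, (s w : ℤ) = ∑ i, w i ^ 2 := fun w =>
    Int.toNat_of_nonneg (Finset.sum_nonneg fun _ _ => sq_nonneg _)
  have h0 : ∑ w ∈ cube d N, rep d (lam - ∑ i, w i ^ 2) ^ 2 =
      ∑ w ∈ (cube d N).filter (fun w => s w ∈ Finset.range (lam + 1)), rep d (lam - s w) ^ 2 := by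
    rw [Finset.sum_filter_of_ne]
    · simp only [hs']
    · intro w _ hne
      by_contra hlt
      rw [Finset.mem_range] at hlt
      apply hne
      rw [rep_eq_zero_of_neg d (by omega)]
      rfl
  have hfib : ∀ m : ℕ, ((cube d N).filter (fun w => s w ∈ Finset.range (lam + 1))
      |>.filter (fun w => s w = m)).card ≤ rep d m := by
    intro m
    have h1 : rep d m = (finite_sum_sq_eq (ι := Fin d) (m : ℤ)).toFinset.card := by
      rw [rep, ← Nat.card_eq_card_finite_toFinset]; rfl
    rw [h1]
    refine Finset.card_le_card fun w hw => ?_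
    rw [Set.Finite.mem_toFinset, Set.mem_ofPred_eq, ← hs', (Finset.mem_filter.1 hw).2]
  rw [h0, ← Finset.sum_fiberwise_of_maps_to (g := s) (t := Finset.range (lam + 1))
    (fun w hw => (Finset.mem_filter.1 hw).2)]
  have h1 : ∀ m ∈ Finset.range (lam + 1),
      ∑ w ∈ ((cube d N).filter (fun w => s w ∈ Finset.range (lam + 1))).filter
        (fun w => s w = m), rep d (lam - s w) ^ 2 ≤
      rep d ((lam + 1 - 1 - m : ℕ) : ℤ) ^ 3 + rep d m ^ 3 := by
    intro m hm
    have hm' : m ≤ lam := Nat.lt_succ_iff.1 (Finset.mem_range.1 hm)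
    rw [Finset.sum_congr rfl (g := fun _ => rep d (lam - m) ^ 2)
      (fun w hw => by rw [(Finset.mem_filter.1 hw).2]), Finset.sum_const, smul_eq_mul]
    refine (Nat.mul_le_mul_right _ (hfib m)).trans ?_
    rw [Nat.add_sub_cancel, Nat.cast_sub hm']
    set a := rep d (lam - m)
    set b := rep d m
    rcases le_total a b with h | h
    · calc b * a ^ 2 ≤ b * b ^ 2 := Nat.mul_le_mul_left _ (Nat.pow_le_pow_left h 2)
        _ = b ^ 3 := by ring
        _ ≤ _ := Nat.le_add_left _ _
    · calc b * a ^ 2 ≤ a * a ^ 2 := Nat.mul_le_mul_right _ h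
        _ = a ^ 3 := by ring
        _ ≤ _ := Nat.le_add_right _ _
  refine (Finset.sum_le_sum h1).trans ?_
  rw [Finset.sum_add_distrib, Finset.sum_range_reflect (fun m => rep d (m : ℤ) ^ 3), ← two_mul]
  exact Nat.mul_le_mul_left _ (Finset.sum_le_sum_of_subset
    (Finset.range_subset_range.2 (by omega)))

/-- Pointwise domination of the bilinear averages in dimensions three and four. -/
lemma weighted_average_le_hlMax_sq (d : ℕ) (hd : 3 ≤ d) (hd' : d ≤ 4) : ∃ C : ℕ,
    ∀ (g : V d → ℝ≥0) (lam : ℕ) (x : V d),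
      (∑' w : V d, (rep d (lam - ∑ i, w i ^ 2) : ℝ≥0∞) * g (x - w)) / rep (d + d) lam ≤
        C * hlMax d (fun y => (g y : ℝ≥0∞) ^ 2) x ^ (1 / 2 : ℝ) := by
  obtain ⟨C₀, h₀⟩ := rep_lower (d + d) (by omega)
  obtain ⟨C₁, h₁⟩ := sum_rep_cube_le d hd hd'
  refine ⟨2 * C₁ * 3 ^ d * C₀, fun g lam x => ENNReal.div_le_of_le_mul ?_⟩
  set N := Nat.sqrt lam + 1 with hN
  have hlam : lam ≤ N ^ 2 := le_succ_sqrt_sq lam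
  set r := rep (d + d) lam
  set H := hlMax d (fun y => (g y : ℝ≥0∞) ^ 2) x with hH
  rw [tsum_rep_eq_sum_cube hlam fun w => (g (x - w) : ℝ≥0∞)]
  set S : ℝ≥0 := ∑ w ∈ cube d N, (rep d (lam - ∑ i, w i ^ 2) : ℝ≥0) * g (x - w) with hS
  have hSe : ∑ w ∈ cube d N, (rep d (lam - ∑ i, w i ^ 2) : ℝ≥0∞) * (g (x - w) : ℝ≥0∞) = S := by
    rw [hS]; push_cast; rfl
  rw [hSe]
  have hcs : S ^ 2 ≤ (∑ w ∈ cube d N, (rep d (lam - ∑ i, w i ^ 2) : ℝ≥0) ^ 2) *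
      ∑ w ∈ cube d N, g (x - w) ^ 2 := Finset.sum_mul_sq_le_sq_mul_sq _ _ _
  have hA : (((∑ w ∈ cube d N, (rep d (lam - ∑ i, w i ^ 2) : ℝ≥0) ^ 2 : ℝ≥0)) : ℝ≥0∞) ≤
      ((2 * (C₁ * N ^ (3 * d - 4)) : ℕ) : ℝ≥0∞) := by
    have := (sum_cube_rep_sq_le d lam N hlam).trans
      (Nat.mul_le_mul_left 2 (h₁ N (by omega)))
    exact_mod_cast this
  have hB : ((∑ w ∈ cube d N, g (x - w) ^ 2 : ℝ≥0) : ℝ≥0∞) ≤ (2 * N + 1 : ℝ≥0∞) ^ d * H := by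
    push_cast
    exact sum_cube_le_hlMax d N (fun y => (g y : ℝ≥0∞) ^ 2) x
  have hnat : 2 * (C₁ * N ^ (3 * d - 4)) * (2 * N + 1) ^ d ≤
      (2 * C₁ * 3 ^ d * C₀ * r) ^ 2 := by
    calc 2 * (C₁ * N ^ (3 * d - 4)) * (2 * N + 1) ^ d
        ≤ 2 * (C₁ * N ^ (3 * d - 4)) * (3 * N) ^ d :=
          Nat.mul_le_mul_left _ (Nat.pow_le_pow_left (by omega) d)
      _ = 2 * C₁ * 3 ^ d * (N ^ (d + d - 2)) ^ 2 := by
          rw [← pow_mul, show (d + d - 2) * 2 = 3 * d - 4 + d by omega, mul_pow, pow_add]; ring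
      _ ≤ (2 * C₁ * 3 ^ d) ^ 2 * (C₀ * r) ^ 2 :=
          Nat.mul_le_mul (Nat.le_self_pow two_ne_zero _) (Nat.pow_le_pow_left (h₀ lam) 2)
      _ = _ := by ring
  have hsq : (S : ℝ≥0∞) ^ 2 ≤ (((2 * C₁ * 3 ^ d * C₀ * r : ℕ) : ℝ≥0∞) * H ^ (1 / 2 : ℝ)) ^ 2 := by
    have hHsq : (H ^ (1 / 2 : ℝ)) ^ 2 = H := by
      rw [← ENNReal.rpow_natCast, ← ENNReal.rpow_mul]; norm_num
    rw [mul_pow, hHsq]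
    calc (S : ℝ≥0∞) ^ 2 = ((S ^ 2 : ℝ≥0) : ℝ≥0∞) := by push_cast; rfl
      _ ≤ _ := ENNReal.coe_le_coe.2 hcs
      _ ≤ ((2 * (C₁ * N ^ (3 * d - 4)) : ℕ) : ℝ≥0∞) * ((2 * N + 1 : ℝ≥0∞) ^ d * H) := by
          rw [ENNReal.coe_mul]; exact mul_le_mul' hA hB
      _ = ((2 * (C₁ * N ^ (3 * d - 4)) * (2 * N + 1) ^ d : ℕ) : ℝ≥0∞) * H := by
          push_cast; ring
      _ ≤ (((2 * C₁ * 3 ^ d * C₀ * r) ^ 2 : ℕ) : ℝ≥0∞) * H :=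
          mul_le_mul_left (by exact_mod_cast hnat) _
      _ = _ := by push_cast; ring
  have hfin := (ENNReal.pow_le_pow_left_iff two_ne_zero).1 hsq
  refine hfin.trans (le_of_eq ?_)
  push_cast; ring

/-- A majorant of all the weighted averages that is bounded on `l^p`. -/
lemma exists_majorant (n d : ℕ) (hn : 1 ≤ n) (hd : 3 ≤ d) (p : ℝ)
    (hp : (d : ℝ) / ((d : ℝ) - 2) < p) : ∃ C : ℝ≥0, ∀ g : V d → ℝ≥0, ∃ H : V d → ℝ≥0∞,
      (∀ (lam : ℕ) (x : V d),
        (∑' w : V d, (rep (n * d) (lam - ∑ i, w i ^ 2) : ℝ≥0∞) * g (x - w)) /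
          rep ((n + 1) * d) lam ≤ H x) ∧
      lpNormE d p H ≤ C * lpNormE d p (fun x => g x) := by
  have hd' : (3 : ℝ) ≤ d := by exact_mod_cast hd
  rw [div_lt_iff₀ (by linarith)] at hp
  have hp1 : 1 < p := by nlinarith
  have hp0 : 0 ≤ p := by linarith
  have key : ∀ (A : ℕ) (D : ℝ≥0) (G F : V d → ℝ≥0∞), ∑' x, G x ^ p ≤ D * ∑' x, F x ^ p →
      lpNormE d p (fun x => A * G x) ≤ ((A * D ^ (1 / p) : ℝ≥0) : ℝ≥0∞) * lpNormE d p F := by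
    intro A D G F h
    simp only [lpNormE, ENNReal.mul_rpow_of_nonneg _ _ hp0]
    rw [ENNReal.tsum_mul_left, ENNReal.mul_rpow_of_nonneg _ _ (by positivity : 0 ≤ 1 / p),
      ← ENNReal.rpow_mul, mul_one_div_cancel (by positivity), ENNReal.rpow_one, ENNReal.coe_mul,
      ENNReal.coe_natCast, ENNReal.coe_rpow_of_nonneg _ (by positivity), mul_assoc,
      ← ENNReal.mul_rpow_of_nonneg _ _ (by positivity : 0 ≤ 1 / p)]
    exact mul_le_mul_right (ENNReal.rpow_le_rpow h (by positivity)) _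
  rw [add_mul, one_mul]
  by_cases hk : 5 ≤ n * d
  · obtain ⟨A, hA⟩ := weighted_average_le_hlMax (n * d) d hk
    obtain ⟨D, hD⟩ := hlMax_strong_type d hp1
    exact ⟨A * D ^ (1 / p), fun g => ⟨fun x => A * hlMax d (fun y => g y) x,
      fun lam x => hA (fun y => g y) lam x, key A D _ _ (hD _)⟩⟩
  · obtain rfl : n = 1 := by nlinarith
    rw [one_mul] at hk ⊢
    have hd4 : d ≤ 4 := by omega
    have hd4' : (d : ℝ) ≤ 4 := by exact_mod_cast hd4
    obtain ⟨A, hA⟩ := weighted_average_le_hlMax_sq d hd hd4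
    obtain ⟨D, hD⟩ := hlMax_strong_type d (show 1 < p / 2 by nlinarith)
    refine ⟨A * D ^ (1 / p), fun g =>
      ⟨fun x => A * hlMax d (fun y => (g y : ℝ≥0∞) ^ 2) x ^ (1 / 2 : ℝ), hA g,
        key A D _ _ ?_⟩⟩
    have h1 : ∀ a : ℝ≥0∞, (a ^ (1 / 2 : ℝ)) ^ p = a ^ (p / 2) := fun a => by
      rw [← ENNReal.rpow_mul]; congr 1; ring
    have h2 : ∀ a : ℝ≥0∞, (a ^ 2) ^ (p / 2) = a ^ p := fun a => by
      rw [← ENNReal.rpow_natCast, ← ENNReal.rpow_mul]; congr 1; push_cast; ring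
    have h3 := hD fun y => (g y : ℝ≥0∞) ^ 2
    simpa only [h1, h2] using h3

/-- For `l ≥ 2`, `d ≥ 3` and `p > d/(d-2)`, the `l`-linear discrete spherical
maximal operator is bounded from `l^∞(ℤ^d) × ⋯ × l^∞(ℤ^d) × l^p(ℤ^d)` to `l^p(ℤ^d)`. -/
theorem multilinear_discrete_spherical_linfty_lp
    (l d : ℕ) (hl : 2 ≤ l) (hd : 3 ≤ d) (p : ℝ) (hp : (d : ℝ) / ((d : ℝ) - 2) < p) :
    ∃ C : ℝ≥0, ∀ f : Fin l → V d → ℂ,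
      lpNormE d p (maxOpM l d f) ≤
        C * (∏ j ∈ Finset.univ.filter (fun j : Fin l => (j : ℕ) < l - 1), linftyNorm d (f j)) *
          lpNorm d p (f ⟨l - 1, by omega⟩) := by
  obtain ⟨n, rfl⟩ : ∃ n, l = n + 1 := ⟨l - 1, by omega⟩
  obtain ⟨C, hC⟩ := exists_majorant n d (by omega) hd p hp
  refine ⟨C, fun f => ?_⟩
  obtain ⟨H, hH, hHp⟩ := hC fun x => ‖f (Fin.last n) x‖₊
  have hp0 : 0 < p := by
    have hd' : (3 : ℝ) ≤ d := by exact_mod_cast hd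
    exact lt_of_le_of_lt (div_nonneg (by linarith) (by linarith)) hp
  have hprod : ∏ j ∈ Finset.univ.filter (fun j : Fin (n + 1) => (j : ℕ) < n + 1 - 1),
      linftyNorm d (f j) = ∏ j : Fin n, linftyNorm d (f j.castSucc) := by
    rw [Finset.prod_filter, Fin.prod_univ_castSucc]
    simp
  rw [hprod]
  set P := ∏ j : Fin n, linftyNorm d (f j.castSucc)
  have hmax : ∀ x, maxOpM (n + 1) d f x ≤ P * H x := fun x =>
    iSup₂_le fun lam hlam => (enorm_avgM_le n d lam hlam f x).trans
      (mul_le_mul_right (hH lam x) P)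
  calc lpNormE d p (maxOpM (n + 1) d f) ≤ lpNormE d p fun x => P * H x :=
        ENNReal.rpow_le_rpow (ENNReal.tsum_le_tsum fun x =>
          ENNReal.rpow_le_rpow (hmax x) hp0.le) (by positivity)
    _ = P * lpNormE d p H := by
        simp only [lpNormE, ENNReal.mul_rpow_of_nonneg _ _ hp0.le]
        rw [ENNReal.tsum_mul_left, ENNReal.mul_rpow_of_nonneg _ _ (by positivity : 0 ≤ 1 / p),
          ← ENNReal.rpow_mul, mul_one_div_cancel hp0.ne', ENNReal.rpow_one]
    _ ≤ P * (C * lpNorm d p (f (Fin.last n))) := mul_le_mul_right hHp P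
    _ = _ := by rw [← mul_assoc, mul_comm P]; rfl
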